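/- arXiv:2601.21366 — 6 statements merged into one kernel-verified Lean document; each statement's English description precedes it below -/
import Mathlib

section
/- Let d ≥ 2, β > 0. The map sending a Borel probability measure μ on the unit sphere S^{d-1} ⊂ ℝ^d to the function f : S^{d-1} → ℝ defined by f(x) = ∫_{S^{d-1}} exp(β ⟨x,y⟩) dμ(y) is injective: if two Borel probability measures μ₁, μ₂ on S^{d-1} satisfy ∫ exp(β ⟨x,y⟩) dμ₁(y) = ∫ exp(β ⟨x,y⟩) dμ₂(y) for every x ∈ S^{d-1}, then μ₁ = μ₂. -/
open MeasureTheory Real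
open scoped RealInnerProductSpace

lemma one_add_sq_div_two_le_cosh (u : ℝ) : 1 + u ^ 2 / 2 ≤ cosh u := by
  have h : |u / 2| ≤ |sinh (u / 2)| := by
    rw [abs_sinh]
    exact self_le_sinh_iff.2 (abs_nonneg _)
  have h2 := sq_le_sq.2 h
  have h3 := cosh_two_mul (u / 2)
  have h4 := cosh_sq (u / 2)
  rw [mul_div_cancel₀ u two_ne_zero] at h3
  nlinarith

lemma cosh_le_one_add_of_abs_le_one {u : ℝ} (hu : |u| ≤ 1) :
    cosh u ≤ 1 + u ^ 2 / 2 + u ^ 4 / 4 := by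
  have hu2 : u ^ 2 ≤ 1 := (sq_le_one_iff_abs_le_one u).2 hu
  have h := abs_exp_sub_one_sub_id_le (x := u ^ 2 / 2)
    (by rw [abs_of_nonneg (by positivity)]; linarith)
  have h2 := (abs_le.1 h).2
  have h3 := cosh_le_exp_half_sq u
  nlinarith

section Laplace

variable {d : ℕ} {μ μ₁ μ₂ : Measure (EuclideanSpace ℝ (Fin d))}

lemma ae_norm_eq_one_of_compl_sphere
    (hμ : μ (Metric.sphere (0 : EuclideanSpace ℝ (Fin d)) 1)ᶜ = 0) : ∀ᵐ y ∂μ, ‖y‖ = 1 := by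
  filter_upwards [compl_mem_ae_iff.2 hμ] with y hy
  simpa using hy

lemma inner_le_norm_of_norm_eq_one {x y : EuclideanSpace ℝ (Fin d)} (hy : ‖y‖ = 1) :
    ⟪x, y⟫ ≤ ‖x‖ := by
  simpa [hy] using real_inner_le_norm x y

lemma integrable_exp_inner [IsFiniteMeasure μ] (hμ : ∀ᵐ y ∂μ, ‖y‖ = 1)
    (x : EuclideanSpace ℝ (Fin d)) : Integrable (fun y ↦ exp ⟪x, y⟫) μ := by
  refine Integrable.of_bound (by fun_prop) (exp ‖x‖) ?_
  filter_upwards [hμ] with y hy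
  rw [norm_of_nonneg (exp_pos _).le]
  exact exp_le_exp.2 (inner_le_norm_of_norm_eq_one hy)

lemma continuousOn_integral_exp_inner [IsFiniteMeasure μ] (hμ : ∀ᵐ y ∂μ, ‖y‖ = 1) (r : ℝ) :
    ContinuousOn (fun x ↦ ∫ y, exp ⟪x, y⟫ ∂μ) (Metric.closedBall 0 r) := by
  refine continuousOn_of_dominated (bound := fun _ ↦ exp r) (fun x _ ↦ by fun_prop) ?_
    (integrable_const _) (.of_forall fun y ↦ by fun_prop)
  intro x hx
  filter_upwards [hμ] with y hy
  rw [norm_of_nonneg (exp_pos _).le]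
  exact exp_le_exp.2 ((inner_le_norm_of_norm_eq_one hy).trans (by simpa using hx))

lemma exp_inner_second_difference (x y : EuclideanSpace ℝ (Fin d)) (t : ℝ) (i : Fin d) :
    exp ⟪x + EuclideanSpace.single i t, y⟫ + exp ⟪x - EuclideanSpace.single i t, y⟫
      - 2 * exp ⟪x, y⟫ = exp ⟪x, y⟫ * (2 * (cosh (t * y i) - 1)) := by
  have h : ⟪EuclideanSpace.single i t, y⟫ = t * y i := by
    simp [EuclideanSpace.inner_single_left]
  rw [inner_add_left, inner_sub_left, h, sub_eq_add_neg ⟪x, y⟫, exp_add, exp_add, cosh_eq]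
  ring

lemma sq_le_sum_cosh {y : EuclideanSpace ℝ (Fin d)} (hy : ‖y‖ = 1) (t : ℝ) :
    t ^ 2 ≤ ∑ i, 2 * (cosh (t * y i) - 1) := by
  have h := EuclideanSpace.real_norm_sq_eq y
  rw [hy] at h
  calc t ^ 2 = ∑ i, t ^ 2 * y i ^ 2 := by rw [← Finset.mul_sum, ← h]; ring
    _ ≤ _ := Finset.sum_le_sum fun i _ ↦ by
      nlinarith [one_add_sq_div_two_le_cosh (t * y i)]

lemma sum_cosh_le {y : EuclideanSpace ℝ (Fin d)} (hy : ‖y‖ = 1) {t : ℝ} (ht : |t| ≤ 1) :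
    ∑ i, 2 * (cosh (t * y i) - 1) ≤ t ^ 2 * (1 + t ^ 2) := by
  have h := EuclideanSpace.real_norm_sq_eq y
  rw [hy] at h
  calc _ ≤ ∑ i, t ^ 2 * (1 + t ^ 2) * y i ^ 2 := Finset.sum_le_sum fun i _ ↦ by
        have hyi : |y i| ≤ 1 := by simpa [hy] using PiLp.norm_apply_le y i
        have hyi2 : y i ^ 2 ≤ 1 := (sq_le_one_iff_abs_le_one _).2 hyi
        have h1 := cosh_le_one_add_of_abs_le_one (u := t * y i)
          (by rw [abs_mul]; exact mul_le_one₀ ht (abs_nonneg _) hyi)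
        have h2 : 0 ≤ t ^ 4 * y i ^ 2 * (1 - y i ^ 2) :=
          mul_nonneg (by positivity) (by linarith)
        have h3 : 0 ≤ t ^ 4 * y i ^ 2 := by positivity
        nlinarith
    _ = _ := by rw [← Finset.mul_sum, ← h]; ring

lemma integrable_exp_inner_mul_sum_cosh [IsFiniteMeasure μ] (hμ : ∀ᵐ y ∂μ, ‖y‖ = 1)
    (x : EuclideanSpace ℝ (Fin d)) (t : ℝ) :
    Integrable (fun y ↦ exp ⟪x, y⟫ * ∑ i, 2 * (cosh (t * y i) - 1)) μ := by
  simp_rw [Finset.mul_sum, ← exp_inner_second_difference]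
  exact integrable_finsetSum _ fun i _ ↦ ((integrable_exp_inner hμ _).add
    (integrable_exp_inner hμ _)).sub ((integrable_exp_inner hμ _).const_mul _)

lemma sum_second_difference_integral_exp_inner [IsFiniteMeasure μ] (hμ : ∀ᵐ y ∂μ, ‖y‖ = 1)
    (x : EuclideanSpace ℝ (Fin d)) (t : ℝ) :
    ∑ i, (∫ y, exp ⟪x + EuclideanSpace.single i t, y⟫ ∂μ
        + ∫ y, exp ⟪x - EuclideanSpace.single i t, y⟫ ∂μ - 2 * ∫ y, exp ⟪x, y⟫ ∂μ)
      = ∫ y, exp ⟪x, y⟫ * ∑ i, 2 * (cosh (t * y i) - 1) ∂μ := by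
  have hi := integrable_exp_inner hμ
  simp_rw [Finset.mul_sum, ← exp_inner_second_difference]
  refine ((integral_finsetSum _ fun i _ ↦
    ((hi _).add (hi _)).sub ((hi _).const_mul _)).trans ?_).symm
  refine Finset.sum_congr rfl fun i _ ↦ ?_
  refine (integral_sub ((hi _).add (hi _)) ((hi _).const_mul _)).trans ?_
  rw [integral_const_mul]
  exact congrArg (· - _) (integral_add (hi _) (hi _))

/-- At an interior local maximum, the difference of the Laplace transforms of two finite measures
on the unit sphere is nonpositive, because it is an eigenfunction of the Laplacian with
eigenvalue `1`. -/
lemma integral_exp_inner_le_of_isLocalMax [IsFiniteMeasure μ₁] [IsFiniteMeasure μ₂]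
    (h₁ : ∀ᵐ y ∂μ₁, ‖y‖ = 1) (h₂ : ∀ᵐ y ∂μ₂, ‖y‖ = 1) {x : EuclideanSpace ℝ (Fin d)}
    (hx : IsLocalMax (fun z ↦ ∫ y, exp ⟪z, y⟫ ∂μ₁ - ∫ y, exp ⟪z, y⟫ ∂μ₂) x) :
    ∫ y, exp ⟪x, y⟫ ∂μ₁ ≤ ∫ y, exp ⟪x, y⟫ ∂μ₂ := by
  obtain ⟨ε, hε, hmax⟩ := Metric.eventually_nhds_iff.1 hx
  have key (t : ℝ) (ht : 0 < t) (htε : t < ε) (ht1 : t ≤ 1) :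
      ∫ y, exp ⟪x, y⟫ ∂μ₁ ≤ (1 + t ^ 2) * ∫ y, exp ⟪x, y⟫ ∂μ₂ := by
    have lower : t ^ 2 * ∫ y, exp ⟪x, y⟫ ∂μ₁
        ≤ ∫ y, exp ⟪x, y⟫ * ∑ i, 2 * (cosh (t * y i) - 1) ∂μ₁ := by
      rw [← integral_const_mul]
      refine integral_mono_ae ((integrable_exp_inner h₁ x).const_mul _)
        (integrable_exp_inner_mul_sum_cosh h₁ x t) ?_
      filter_upwards [h₁] with y hy
      rw [mul_comm]
      exact mul_le_mul_of_nonneg_left (sq_le_sum_cosh hy t) (exp_pos _).le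
    have upper : ∫ y, exp ⟪x, y⟫ * ∑ i, 2 * (cosh (t * y i) - 1) ∂μ₂
        ≤ t ^ 2 * (1 + t ^ 2) * ∫ y, exp ⟪x, y⟫ ∂μ₂ := by
      rw [← integral_const_mul]
      refine integral_mono_ae (integrable_exp_inner_mul_sum_cosh h₂ x t)
        ((integrable_exp_inner h₂ x).const_mul _) ?_
      filter_upwards [h₂] with y hy
      rw [mul_comm (t ^ 2 * _)]
      exact mul_le_mul_of_nonneg_left (sum_cosh_le hy (by rwa [abs_of_pos ht])) (exp_pos _).le
    have diff : ∫ y, exp ⟪x, y⟫ * ∑ i, 2 * (cosh (t * y i) - 1) ∂μ₁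
        ≤ ∫ y, exp ⟪x, y⟫ * ∑ i, 2 * (cosh (t * y i) - 1) ∂μ₂ := by
      rw [← sum_second_difference_integral_exp_inner h₁,
        ← sum_second_difference_integral_exp_inner h₂]
      refine Finset.sum_le_sum fun i _ ↦ ?_
      have hp := hmax (y := x + EuclideanSpace.single i t)
        (by simpa [dist_eq_norm, abs_of_pos ht] using htε)
      have hm := hmax (y := x - EuclideanSpace.single i t)
        (by simpa [dist_eq_norm, abs_of_pos ht] using htε)
      linarith
    have ht2 : 0 < t ^ 2 := by positivity
    refine le_of_mul_le_mul_left ?_ ht2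
    linarith
  have hlim : Filter.Tendsto (fun t : ℝ ↦ (1 + t ^ 2) * ∫ y, exp ⟪x, y⟫ ∂μ₂)
      (nhdsWithin 0 (Set.Ioi 0)) (nhds (∫ y, exp ⟪x, y⟫ ∂μ₂)) := by
    have hc : Continuous (fun t : ℝ ↦ (1 + t ^ 2) * ∫ y, exp ⟪x, y⟫ ∂μ₂) := by fun_prop
    simpa using (hc.tendsto 0).mono_left nhdsWithin_le_nhds
  refine ge_of_tendsto hlim ?_
  filter_upwards [Ioo_mem_nhdsGT (lt_min hε one_pos)] with t ht
  exact key t ht.1 (ht.2.trans_le (min_le_left _ _)) (ht.2.le.trans (min_le_right _ _))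

/-- Maximum principle: an inequality between Laplace transforms of measures on the unit sphere
that holds on a sphere around the origin holds on the enclosed ball. -/
lemma integral_exp_inner_le_on_closedBall [IsFiniteMeasure μ₁] [IsFiniteMeasure μ₂]
    (h₁ : ∀ᵐ y ∂μ₁, ‖y‖ = 1) (h₂ : ∀ᵐ y ∂μ₂, ‖y‖ = 1) {r : ℝ}
    (h : ∀ x ∈ Metric.sphere (0 : EuclideanSpace ℝ (Fin d)) r,
      ∫ y, exp ⟪x, y⟫ ∂μ₁ ≤ ∫ y, exp ⟪x, y⟫ ∂μ₂)
    {x : EuclideanSpace ℝ (Fin d)} (hx : x ∈ Metric.closedBall 0 r) :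
    ∫ y, exp ⟪x, y⟫ ∂μ₁ ≤ ∫ y, exp ⟪x, y⟫ ∂μ₂ := by
  obtain ⟨z, hz, hmax⟩ := (isCompact_closedBall (0 : EuclideanSpace ℝ (Fin d)) r).exists_isMaxOn
    ⟨x, hx⟩ ((continuousOn_integral_exp_inner h₁ r).sub (continuousOn_integral_exp_inner h₂ r))
  have hzle : ∫ y, exp ⟪z, y⟫ ∂μ₁ ≤ ∫ y, exp ⟪z, y⟫ ∂μ₂ := by
    rcases (mem_closedBall_zero_iff.1 hz).eq_or_lt with hzr | hzr
    · exact h z (mem_sphere_zero_iff_norm.2 hzr)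
    · refine integral_exp_inner_le_of_isLocalMax h₁ h₂ (hmax.isLocalMax ?_)
      exact Filter.mem_of_superset (Metric.isOpen_ball.mem_nhds (mem_ball_zero_iff.2 hzr))
        Metric.ball_subset_closedBall
  have hxz := isMaxOn_iff.1 hmax x hx
  simp only [Pi.sub_apply] at hxz
  linarith

lemma integrableExpSet_inner [IsFiniteMeasure μ] (hμ : ∀ᵐ y ∂μ, ‖y‖ = 1)
    (u : EuclideanSpace ℝ (Fin d)) :
    ProbabilityTheory.integrableExpSet (fun y ↦ ⟪y, u⟫) μ = Set.univ := by
  refine Set.eq_univ_of_forall fun t ↦ ?_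
  have h := integrable_exp_inner hμ (t • u)
  simp_rw [real_inner_smul_left] at h
  simpa [ProbabilityTheory.integrableExpSet, real_inner_comm] using h

/-- Probability measures on the unit sphere whose Laplace transforms agree near the origin are equal. -/
lemma eq_of_integral_exp_inner_eq_on_ball [IsProbabilityMeasure μ₁] [IsProbabilityMeasure μ₂]
    (h₁ : ∀ᵐ y ∂μ₁, ‖y‖ = 1) (h₂ : ∀ᵐ y ∂μ₂, ‖y‖ = 1) {r : ℝ} (hr : 0 < r)
    (h : ∀ x ∈ Metric.closedBall (0 : EuclideanSpace ℝ (Fin d)) r,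
      ∫ y, exp ⟪x, y⟫ ∂μ₁ = ∫ y, exp ⟪x, y⟫ ∂μ₂) : μ₁ = μ₂ := by
  refine Measure.ext_of_charFun (funext fun u ↦ ?_)
  have ha₁ := ProbabilityTheory.analyticOnNhd_mgf (X := fun y ↦ ⟪y, u⟫) (μ := μ₁)
  have ha₂ := ProbabilityTheory.analyticOnNhd_mgf (X := fun y ↦ ⟪y, u⟫) (μ := μ₂)
  rw [integrableExpSet_inner h₁, interior_univ] at ha₁
  rw [integrableExpSet_inner h₂, interior_univ] at ha₂
  have hmgf : ProbabilityTheory.mgf (fun y ↦ ⟪y, u⟫) μ₁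
      = ProbabilityTheory.mgf (fun y ↦ ⟪y, u⟫) μ₂ := by
    refine ha₁.eq_of_eventuallyEq ha₂ (z₀ := 0) ?_
    have hc : Continuous (fun t : ℝ ↦ t • u) := by fun_prop
    have hev : ∀ᶠ t : ℝ in nhds 0, t • u ∈ Metric.closedBall 0 r :=
      hc.continuousAt.preimage_mem_nhds (by simpa using Metric.closedBall_mem_nhds 0 hr)
    filter_upwards [hev] with t ht
    have := h _ ht
    simp_rw [real_inner_smul_left] at this
    simpa [ProbabilityTheory.mgf, real_inner_comm] using this
  have hI := ProbabilityTheory.eqOn_complexMGF_of_mgf hmgf (x := Complex.I)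
    (by simp [integrableExpSet_inner h₁])
  simpa [ProbabilityTheory.complexMGF, charFun_apply, mul_comm] using hI

end Laplace

/-- **Injectivity of the attention transform** (Lemma `quadpol`, injectivity part).
If two Borel probability measures on the unit sphere `S^{d-1} ⊆ ℝ^d` have the same
attention transform `x ↦ ∫ exp (β ⟨x, y⟩) dμ(y)` on the sphere, they coincide. -/
theorem attention_transform_injective
    (d : ℕ) (hd : 2 ≤ d) (β : ℝ) (hβ : 0 < β)
    (μ₁ μ₂ : Measure (EuclideanSpace ℝ (Fin d)))
    [IsProbabilityMeasure μ₁] [IsProbabilityMeasure μ₂]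
    (hs₁ : μ₁ (Metric.sphere (0 : EuclideanSpace ℝ (Fin d)) 1)ᶜ = 0)
    (hs₂ : μ₂ (Metric.sphere (0 : EuclideanSpace ℝ (Fin d)) 1)ᶜ = 0)
    (h : ∀ x ∈ Metric.sphere (0 : EuclideanSpace ℝ (Fin d)) 1,
      ∫ y, Real.exp (β * ⟪x, y⟫) ∂μ₁ = ∫ y, Real.exp (β * ⟪x, y⟫) ∂μ₂) :
    μ₁ = μ₂ := by
  have h₁ := ae_norm_eq_one_of_compl_sphere hs₁
  have h₂ := ae_norm_eq_one_of_compl_sphere hs₂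
  have hsphere : ∀ x ∈ Metric.sphere (0 : EuclideanSpace ℝ (Fin d)) β,
      ∫ y, exp ⟪x, y⟫ ∂μ₁ = ∫ y, exp ⟪x, y⟫ ∂μ₂ := by
    intro x hx
    have hx' : ‖x‖ = β := mem_sphere_zero_iff_norm.1 hx
    have := h (β⁻¹ • x) (by simp [norm_smul, hx', abs_of_pos hβ, hβ.ne'])
    simpa [real_inner_smul_left, mul_inv_cancel_left₀ hβ.ne'] using this
  exact eq_of_integral_exp_inner_eq_on_ball h₁ h₂ hβ fun x hx ↦ le_antisymm
    (integral_exp_inner_le_on_closedBall h₁ h₂ (fun z hz ↦ (hsphere z hz).le) hx)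
    (integral_exp_inner_le_on_closedBall h₂ h₁ (fun z hz ↦ (hsphere z hz).ge) hx)
end

section
/- Let d ≥ 2, β > 0, let μ be a Borel probability measure on the unit sphere S^{d-1} ⊂ ℝ^d, and define f : S^{d-1} → ℝ by f(x) = ∫ exp(β ⟨x,y⟩) dμ(y). Then f is even (i.e. f(-x) = f(x) for all x ∈ S^{d-1}) if and only if μ is antipodally symmetric, i.e. μ(A) = μ(-A) for every Borel set A ⊆ S^{d-1}. -/
open MeasureTheory Real
open scoped RealInnerProductSpace

section Gaussian

variable {V : Type*} [NormedAddCommGroup V] [InnerProductSpace ℝ V] [FiniteDimensional ℝ V]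
  [MeasurableSpace V] [BorelSpace V]

lemma integrable_rexp_neg_mul_sq_norm {b : ℝ} (hb : 0 < b) :
    Integrable fun v : V ↦ rexp (-b * ‖v‖ ^ 2) := by
  have h := (GaussianFourier.integrable_cexp_neg_mul_sq_norm_add (V := V) (b := (b : ℂ))
    (by simpa using hb) 0 0).re
  refine h.congr (.of_forall fun v ↦ ?_)
  simp only [zero_mul, add_zero]
  rw [← Complex.ofReal_neg, ← Complex.ofReal_pow, ← Complex.ofReal_mul, ← Complex.ofReal_exp]
  rfl

/-- The cosine transform of a Gaussian is a multiple of a Gaussian. -/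
lemma integral_rexp_neg_mul_sq_norm_mul_cos_inner {b : ℝ} (hb : 0 < b) (w : V) :
    ∫ v : V, rexp (-b * ‖v‖ ^ 2) * cos ⟪w, v⟫ =
      ((π / b : ℂ) ^ (Module.finrank ℝ V / 2 : ℂ)).re * rexp (-‖w‖ ^ 2 / (4 * b)) := by
  have hb' : 0 < (b : ℂ).re := by simpa using hb
  have h := congrArg Complex.re
    (GaussianFourier.integral_cexp_neg_mul_sq_norm_add hb' Complex.I w)
  have hint := integral_re
    (GaussianFourier.integrable_cexp_neg_mul_sq_norm_add hb' Complex.I w)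
  have hexp : Complex.exp (Complex.I ^ 2 * ‖w‖ ^ 2 / (4 * b)) =
      (rexp (-‖w‖ ^ 2 / (4 * b)) : ℂ) := by
    push_cast
    simp
  rw [hexp, Complex.re_mul_ofReal] at h
  rw [← h]
  refine Eq.trans (integral_congr_ae (.of_forall fun v ↦ ?_)) hint
  simp [Complex.exp_re, ← Complex.ofReal_pow]

end Gaussian

section Symmetry

variable {V : Type*} [NormedAddCommGroup V] [InnerProductSpace ℝ V]
  [MeasurableSpace V] [BorelSpace V]

lemma integrable_sin_inner [SecondCountableTopology V] (μ : Measure V) [IsFiniteMeasure μ]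
    (t : V) : Integrable (fun x ↦ sin ⟪x, t⟫) μ :=
  (integrable_const (1 : ℝ)).mono (by fun_prop) (.of_forall fun x ↦ by
    simpa using abs_sin_le_one ⟪x, t⟫)

lemma im_charFun [SecondCountableTopology V] (μ : Measure V) [IsFiniteMeasure μ] (t : V) :
    (charFun μ t).im = ∫ x, sin ⟪x, t⟫ ∂μ := by
  have hint : Integrable (fun x ↦ Complex.exp (⟪x, t⟫ * Complex.I)) μ :=
    (integrable_const (1 : ℝ)).mono (by fun_prop) (.of_forall fun x ↦ by simp)
  rw [charFun_apply]
  refine Eq.trans (integral_im hint).symm (integral_congr_ae (.of_forall fun x ↦ ?_))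
  simp [Complex.exp_im]

lemma map_neg_eq_of_im_charFun_eq_zero [SecondCountableTopology V] [CompleteSpace V]
    (μ : Measure V) [IsFiniteMeasure μ] (h : ∀ t, (charFun μ t).im = 0) :
    μ.map (fun x ↦ -x) = μ := by
  refine Measure.ext_of_charFun (funext fun t ↦ ?_)
  have hmap := charFun_map_smul (μ := μ) (-1) t
  simp only [neg_smul, one_smul] at hmap
  rw [hmap, charFun_neg]
  exact Complex.conj_eq_iff_im.2 (h t)

variable [FiniteDimensional ℝ V]

/-- A Gaussian average of the square of the imaginary part of the characteristic function,
computed by means of Fubini's theorem. -/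
lemma integral_rexp_mul_sq_im_charFun (μ : Measure V) [IsProbabilityMeasure μ] {b : ℝ}
    (hb : 0 < b) :
    ∫ t : V, rexp (-b * ‖t‖ ^ 2) * (charFun μ t).im ^ 2 =
      ((π / b : ℂ) ^ (Module.finrank ℝ V / 2 : ℂ)).re / 2 *
        ∫ p : V × V, (rexp (-‖p.1 - p.2‖ ^ 2 / (4 * b)) - rexp (-‖p.1 + p.2‖ ^ 2 / (4 * b)))
          ∂(μ.prod μ) := by
  have hw := integrable_rexp_neg_mul_sq_norm (V := V) hb
  have hcos (z : V) : Integrable fun t : V ↦ rexp (-b * ‖t‖ ^ 2) * cos ⟪z, t⟫ :=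
    hw.mono (by fun_prop) (.of_forall fun t ↦ by
      simpa using mul_le_of_le_one_right (exp_nonneg _) (abs_cos_le_one _))
  have hint : Integrable (Function.uncurry fun (t : V) (p : V × V) ↦
      rexp (-b * ‖t‖ ^ 2) * (sin ⟪p.1, t⟫ * sin ⟪p.2, t⟫)) (volume.prod (μ.prod μ)) := by
    refine (hw.mul_prod (integrable_const (1 : ℝ))).mono ?_ (.of_forall fun q ↦ ?_)
    · exact Continuous.aestronglyMeasurable (by unfold Function.uncurry; fun_prop)
    · simp only [Function.uncurry, norm_mul, norm_eq_abs, mul_one, abs_exp]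
      exact mul_le_of_le_one_right (exp_nonneg _)
        (mul_le_one₀ (abs_sin_le_one _) (abs_nonneg _) (abs_sin_le_one _))
  calc
    _ = ∫ t : V, ∫ p : V × V, rexp (-b * ‖t‖ ^ 2) * (sin ⟪p.1, t⟫ * sin ⟪p.2, t⟫)
          ∂(μ.prod μ) := by
      refine integral_congr_ae (.of_forall fun t ↦ ?_)
      simp only
      rw [integral_const_mul, integral_prod_mul (fun x ↦ sin ⟪x, t⟫) (fun x ↦ sin ⟪x, t⟫),
        im_charFun, sq (∫ x, sin ⟪x, t⟫ ∂μ)]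
    _ = ∫ p : V × V, (∫ t : V, rexp (-b * ‖t‖ ^ 2) * (sin ⟪p.1, t⟫ * sin ⟪p.2, t⟫))
          ∂(μ.prod μ) := integral_integral_swap hint
    _ = _ := by
      rw [← integral_const_mul]
      refine integral_congr_ae (.of_forall fun p ↦ ?_)
      have hprod (t : V) : rexp (-b * ‖t‖ ^ 2) * (sin ⟪p.1, t⟫ * sin ⟪p.2, t⟫) =
          1 / 2 * (rexp (-b * ‖t‖ ^ 2) * cos ⟪p.1 - p.2, t⟫ -
            rexp (-b * ‖t‖ ^ 2) * cos ⟪p.1 + p.2, t⟫) := by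
        rw [inner_sub_left, inner_add_left, cos_sub, cos_add]
        ring
      simp only [hprod]
      rw [integral_const_mul, integral_sub (hcos _) (hcos _),
        integral_rexp_neg_mul_sq_norm_mul_cos_inner hb,
        integral_rexp_neg_mul_sq_norm_mul_cos_inner hb]
      ring

lemma im_charFun_eq_zero_of_integral_rexp_mul_sq_eq_zero (μ : Measure V) [IsProbabilityMeasure μ]
    {b : ℝ} (hb : 0 < b) (h : ∫ t : V, rexp (-b * ‖t‖ ^ 2) * (charFun μ t).im ^ 2 = 0) (t : V) :
    (charFun μ t).im = 0 := by
  have hcont : Continuous fun t ↦ (charFun μ t).im := by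
    simp only [im_charFun]
    exact continuous_of_dominated (bound := fun _ ↦ 1)
      (fun t ↦ (integrable_sin_inner μ t).aestronglyMeasurable)
      (fun t ↦ .of_forall fun x ↦ abs_sin_le_one _) (integrable_const _)
      (.of_forall fun x ↦ by fun_prop)
  have hF : Continuous fun t : V ↦ rexp (-b * ‖t‖ ^ 2) * (charFun μ t).im ^ 2 := by fun_prop
  have hle (t : V) : (charFun μ t).im ^ 2 ≤ 1 := by
    rw [sq_le_one_iff_abs_le_one]
    exact (Complex.abs_im_le_norm _).trans (norm_charFun_le_one t)
  have hint : Integrable fun t : V ↦ rexp (-b * ‖t‖ ^ 2) * (charFun μ t).im ^ 2 :=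
    (integrable_rexp_neg_mul_sq_norm (V := V) hb).mono hF.aestronglyMeasurable
      (.of_forall fun t ↦ by
        rw [norm_of_nonneg (by positivity), norm_of_nonneg (by positivity)]
        exact mul_le_of_le_one_right (exp_nonneg _) (hle t))
  have hae := (integral_eq_zero_iff_of_nonneg (fun t ↦ by positivity) hint).1 h
  have hzero : rexp (-b * ‖t‖ ^ 2) * (charFun μ t).im ^ 2 = 0 :=
    congrFun ((hF.ae_eq_iff_eq volume continuous_const).1 hae) t
  simpa [exp_ne_zero] using hzero

/-- If the exponential transform of a probability measure carried by the unit sphere is even on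
the sphere, then the measure is invariant under the antipodal map. -/
lemma map_neg_eq_of_integral_rexp_inner_even (μ : Measure V) [IsProbabilityMeasure μ] {β : ℝ}
    (hβ : 0 < β) (hs : ∀ᵐ x ∂μ, ‖x‖ = 1)
    (h : ∀ x : V, ‖x‖ = 1 → ∫ y, rexp (β * ⟪-x, y⟫) ∂μ = ∫ y, rexp (β * ⟪x, y⟫) ∂μ) :
    μ.map (fun x ↦ -x) = μ := by
  have hb : 0 < 1 / (2 * β) := by positivity
  refine map_neg_eq_of_im_charFun_eq_zero μ
    (im_charFun_eq_zero_of_integral_rexp_mul_sq_eq_zero μ hb ?_)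
  rw [integral_rexp_mul_sq_im_charFun μ hb]
  refine mul_eq_zero_of_right _ ?_
  have hbound (z : V) : ‖rexp (-‖z‖ ^ 2 / (4 * (1 / (2 * β))))‖ ≤ ‖(1 : ℝ)‖ := by
    rw [norm_one, norm_eq_abs, abs_exp, exp_le_one_iff]
    exact div_nonpos_of_nonpos_of_nonneg (by simp) (by positivity)
  have hint : Integrable (fun p : V × V ↦ rexp (-‖p.1 - p.2‖ ^ 2 / (4 * (1 / (2 * β)))) -
      rexp (-‖p.1 + p.2‖ ^ 2 / (4 * (1 / (2 * β))))) (μ.prod μ) :=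
    ((integrable_const (1 : ℝ)).mono (by fun_prop) (.of_forall fun p ↦ hbound _)).sub
      ((integrable_const (1 : ℝ)).mono (by fun_prop) (.of_forall fun p ↦ hbound _))
  rw [integral_prod _ hint]
  refine integral_eq_zero_of_ae ?_
  filter_upwards [hs] with x hx
  have hexp (x : V) (hx : ‖x‖ = 1) : Integrable (fun y ↦ rexp (β * ⟪x, y⟫)) μ := by
    refine (integrable_const (rexp β)).mono (by fun_prop) ?_
    filter_upwards [hs] with y hy
    rw [norm_eq_abs, norm_eq_abs, abs_exp, abs_exp, exp_le_exp]
    have := real_inner_le_norm x y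
    rw [hx, hy] at this
    nlinarith
  calc
    _ = ∫ y, rexp (-β) * (rexp (β * ⟪x, y⟫) - rexp (β * ⟪-x, y⟫)) ∂μ := by
      refine integral_congr_ae ?_
      filter_upwards [hs] with y hy
      simp only [mul_sub, ← exp_add]
      rw [norm_sub_sq_real, norm_add_sq_real, hx, hy, inner_neg_left]
      congr 2 <;> field_simp <;> ring
    _ = 0 := by
      rw [integral_const_mul, integral_sub (hexp x hx) (hexp (-x) (by simpa using hx)), h x hx,
        sub_self, mul_zero]

end Symmetry

/-- **Parity characterization** (Lemma `quadpol` (ii)). For a Borel probability measure `μ`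
on the unit sphere, the transform `f(x) = ∫ exp (β ⟨x, y⟩) dμ(y)` is even if and only if
`μ` is antipodally symmetric, i.e. `μ A = μ (-A)` for every Borel set `A ⊆ S^{d-1}`. -/
theorem attention_transform_even_iff_antipodal
    (d : ℕ) (hd : 2 ≤ d) (β : ℝ) (hβ : 0 < β)
    (μ : Measure (EuclideanSpace ℝ (Fin d))) [IsProbabilityMeasure μ]
    (hs : μ (Metric.sphere (0 : EuclideanSpace ℝ (Fin d)) 1)ᶜ = 0) :
    (∀ x ∈ Metric.sphere (0 : EuclideanSpace ℝ (Fin d)) 1,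
        ∫ y, Real.exp (β * ⟪-x, y⟫) ∂μ = ∫ y, Real.exp (β * ⟪x, y⟫) ∂μ)
      ↔ (∀ A : Set (EuclideanSpace ℝ (Fin d)), MeasurableSet A →
          A ⊆ Metric.sphere (0 : EuclideanSpace ℝ (Fin d)) 1 → μ A = μ (-A)) := by
  have hsphere : ∀ᵐ x ∂μ, ‖x‖ = 1 := by
    have h : ∀ᵐ x ∂μ, x ∈ Metric.sphere (0 : EuclideanSpace ℝ (Fin d)) 1 := hs
    simpa using h
  constructor
  · intro h A hA _
    have hmap := map_neg_eq_of_integral_rexp_inner_even μ hβ hsphere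
      fun x hx ↦ h x (by simpa using hx)
    conv_lhs => rw [← hmap, Measure.map_apply measurable_neg hA]
    rfl
  · intro h x _
    have hmap : μ.map (fun x ↦ -x) = μ := by
      ext A hA
      rw [Measure.map_apply measurable_neg hA]
      have hA' := h (A ∩ Metric.sphere 0 1) (hA.inter Metric.isClosed_sphere.measurableSet)
        Set.inter_subset_right
      have hmem (B : Set (EuclideanSpace ℝ (Fin d))) : μ (B ∩ Metric.sphere 0 1) = μ B :=
        measure_inter_conull hs
      rw [Set.inter_neg, neg_sphere, neg_zero, hmem, hmem] at hA'
      exact hA'.symm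
    calc
      _ = ∫ y, rexp (β * ⟪x, -y⟫) ∂μ := by simp only [inner_neg_left, inner_neg_right]
      _ = ∫ y, rexp (β * ⟪x, y⟫) ∂(μ.map fun x ↦ -x) :=
        (integral_map (φ := fun x ↦ -x) (f := fun y ↦ rexp (β * ⟪x, y⟫)) (by fun_prop)
          (by fun_prop)).symm
      _ = _ := by rw [hmap]
end

section
/- Let d ≥ 2 and β > 0. For any two distinct Borel probability measures μ₁, μ₂ on the unit sphere S^{d-1} ⊂ ℝ^d, one has ∬ exp(β ⟨x,y⟩) dμ₁(x) dμ₁(y) + ∬ exp(β ⟨x,y⟩) dμ₂(x) dμ₂(y) > 2 ∬ exp(β ⟨x,y⟩) dμ₁(x) dμ₂(y). In other words, the kernel exp(β ⟨x,y⟩) is conditionally strictly positive definite on S^{d-1}: the interaction energy ∬ exp(β ⟨x,y⟩) dν dν is strictly positive for any nonzero signed measure ν = μ₁ - μ₂ with total mass zero. -/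
open MeasureTheory Real
open scoped RealInnerProductSpace

open ProbabilityTheory

/-- The standard Gaussian measure charges every nonempty open set. -/
theorem isOpenPosMeasure_stdGaussian (ι : Type*) [Fintype ι] :
    (stdGaussian (EuclideanSpace ℝ ι)).IsOpenPosMeasure := by
  have : (gaussianReal 0 1).IsOpenPosMeasure :=
    (gaussianReal_absolutelyContinuous' 0 one_ne_zero).isOpenPosMeasure
  rw [← map_pi_eq_stdGaussian]
  exact (PiLp.continuous_toLp 2 _).isOpenPosMeasure_map (WithLp.toLp_surjective 2)

section

variable {E : Type*} [NormedAddCommGroup E] [InnerProductSpace ℝ E] [MeasurableSpace E]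
  [BorelSpace E] [SecondCountableTopology E]

/-- Integrating the positive definite kernel `charFun γ (s • (x - y))` against `μ ⊗ ν` amounts to
integrating the product of the characteristic functions against `γ`. -/
theorem integral_integral_charFun_smul_sub (μ ν γ : Measure E) [IsFiniteMeasure μ]
    [IsFiniteMeasure ν] [IsFiniteMeasure γ] (s : ℝ) :
    ∫ x, ∫ y, charFun γ (s • (x - y)) ∂ν ∂μ =
      ∫ g, charFun μ (s • g) * (starRingEnd ℂ) (charFun ν (s • g)) ∂γ := by
  have hexp (x y g : E) : Complex.exp (⟪g, s • (x - y)⟫ * Complex.I) =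
      Complex.exp (⟪x, s • g⟫ * Complex.I) * Complex.exp (⟪y, -(s • g)⟫ * Complex.I) := by
    rw [← Complex.exp_add]
    congr 1
    simp only [inner_smul_right, inner_sub_right, inner_neg_right, real_inner_comm g]
    push_cast
    ring
  have hnorm (r : ℝ) : ‖Complex.exp (r * Complex.I)‖ = 1 := Complex.norm_exp_ofReal_mul_I r
  have hinner (x : E) : ∫ y, charFun γ (s • (x - y)) ∂ν =
      ∫ g, Complex.exp (⟪x, s • g⟫ * Complex.I) * charFun ν (-(s • g)) ∂γ := by
    simp_rw [charFun_apply (μ := γ), hexp]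
    rw [integral_integral_swap]
    · simp_rw [integral_const_mul, charFun_apply]
    · refine Integrable.of_bound (C := 1) (Continuous.aestronglyMeasurable ?_) (ae_of_all _ ?_)
      · unfold Function.uncurry
        fun_prop
      · rintro ⟨y, g⟩
        simp [Function.uncurry, hnorm, -inner_neg_right]
  simp_rw [hinner, ← charFun_neg]
  rw [integral_integral_swap]
  · simp_rw [integral_mul_const, charFun_apply (μ := μ)]
  · refine Integrable.of_bound (C := ν.real Set.univ) ?_ (ae_of_all _ ?_)
    · refine Measurable.aestronglyMeasurable ?_
      unfold Function.uncurry
      have := measurable_charFun (μ := ν)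
      fun_prop
    · rintro ⟨y, g⟩
      simpa [Function.uncurry, hnorm, -charFun_neg] using norm_charFun_le (μ := ν) (-(s • g))

end

/-- On the unit sphere, the energy of `exp (β ⟨x,y⟩)` is a weighted `L²` inner product of
characteristic functions. -/
theorem integral_integral_exp_mul_inner_eq {ι : Type*} [Fintype ι] {β : ℝ} (hβ : 0 ≤ β)
    (μ ν : Measure (EuclideanSpace ℝ ι)) [IsFiniteMeasure μ] [IsFiniteMeasure ν]
    (hμ : ∀ᵐ x ∂μ, ‖x‖ = 1) (hν : ∀ᵐ x ∂ν, ‖x‖ = 1) :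
    ∫ x, ∫ y, Real.exp (β * ⟪x, y⟫) ∂ν ∂μ =
      Real.exp β * ∫ g, ⟪charFun ν (√β • g), charFun μ (√β • g)⟫
        ∂(stdGaussian (EuclideanSpace ℝ ι)) := by
  have hker (x y : EuclideanSpace ℝ ι) (hx : ‖x‖ = 1) (hy : ‖y‖ = 1) :
      ((Real.exp (β * ⟪x, y⟫) : ℝ) : ℂ) = Complex.exp β *
        charFun (stdGaussian (EuclideanSpace ℝ ι)) (√β • (x - y)) := by
    have hsq : ‖√β • (x - y)‖ ^ 2 = β * (2 - 2 * ⟪x, y⟫) := by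
      rw [norm_smul, mul_pow, norm_sub_sq_real, hx, hy, Real.norm_eq_abs, sq_abs, Real.sq_sqrt hβ]
      ring
    rw [charFun_stdGaussian, ← Complex.exp_add, ← Complex.ofReal_pow, hsq]
    push_cast
    congr 1
    ring
  have hint : Integrable (fun g ↦ charFun μ (√β • g) * (starRingEnd ℂ) (charFun ν (√β • g)))
      (stdGaussian (EuclideanSpace ℝ ι)) := by
    have h1 := measurable_charFun (μ := μ)
    have h2 := measurable_charFun (μ := ν)
    refine Integrable.of_bound (C := μ.real Set.univ * ν.real Set.univ)
      (Measurable.aestronglyMeasurable ?_) (ae_of_all _ fun g ↦ ?_)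
    · simp_rw [← charFun_neg]
      fun_prop
    · rw [norm_mul, RCLike.norm_conj]
      gcongr <;> exact norm_charFun_le _
  have hC : ((∫ x, ∫ y, Real.exp (β * ⟪x, y⟫) ∂ν ∂μ : ℝ) : ℂ) =
      (Real.exp β : ℝ) * ∫ g, charFun μ (√β • g) * (starRingEnd ℂ) (charFun ν (√β • g))
        ∂(stdGaussian (EuclideanSpace ℝ ι)) := by
    rw [← integral_integral_charFun_smul_sub, ← integral_const_mul, ← integral_complex_ofReal]
    refine integral_congr_ae (hμ.mono fun x hx ↦ ?_)
    simp only
    rw [← integral_const_mul, ← integral_complex_ofReal]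
    refine integral_congr_ae (hν.mono fun y hy ↦ ?_)
    simpa using hker x y hx hy
  have hre := congrArg Complex.re hC
  rw [Complex.ofReal_re, Complex.re_ofReal_mul] at hre
  rw [hre]
  congr 1
  simpa [Complex.inner] using (integral_re hint).symm

/-- **Conditional strict positive definiteness of the kernel `exp (β ⟨x,y⟩)`**.
For two distinct Borel probability measures `μ₁ ≠ μ₂` on the unit sphere, the interaction
energy of the difference is strictly positive:
`∬ e^{β⟨x,y⟩} dμ₁ dμ₁ + ∬ e^{β⟨x,y⟩} dμ₂ dμ₂ > 2 ∬ e^{β⟨x,y⟩} dμ₁ dμ₂`. -/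
theorem kernel_conditionally_strictly_positive_definite
    (d : ℕ) (hd : 2 ≤ d) (β : ℝ) (hβ : 0 < β)
    (μ₁ μ₂ : Measure (EuclideanSpace ℝ (Fin d)))
    [IsProbabilityMeasure μ₁] [IsProbabilityMeasure μ₂]
    (hs₁ : μ₁ (Metric.sphere (0 : EuclideanSpace ℝ (Fin d)) 1)ᶜ = 0)
    (hs₂ : μ₂ (Metric.sphere (0 : EuclideanSpace ℝ (Fin d)) 1)ᶜ = 0)
    (hne : μ₁ ≠ μ₂) :
    (∫ x, ∫ y, Real.exp (β * ⟪x, y⟫) ∂μ₁ ∂μ₁)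
      + (∫ x, ∫ y, Real.exp (β * ⟪x, y⟫) ∂μ₂ ∂μ₂)
      > 2 * ∫ x, ∫ y, Real.exp (β * ⟪x, y⟫) ∂μ₂ ∂μ₁ := by
  have ae_norm {μ : Measure (EuclideanSpace ℝ (Fin d))}
      (h : μ (Metric.sphere (0 : EuclideanSpace ℝ (Fin d)) 1)ᶜ = 0) : ∀ᵐ x ∂μ, ‖x‖ = 1 := by
    have h' : ∀ᵐ x ∂μ, x ∈ Metric.sphere (0 : EuclideanSpace ℝ (Fin d)) 1 := h
    simpa using h'
  have h₁ := ae_norm hs₁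
  have h₂ := ae_norm hs₂
  rw [integral_integral_exp_mul_inner_eq hβ.le μ₁ μ₁ h₁ h₁,
    integral_integral_exp_mul_inner_eq hβ.le μ₂ μ₂ h₂ h₂,
    integral_integral_exp_mul_inner_eq hβ.le μ₁ μ₂ h₁ h₂]
  have hc (μ : Measure (EuclideanSpace ℝ (Fin d))) [IsProbabilityMeasure μ] :
      Continuous fun g ↦ charFun μ (√β • g) :=
    continuous_charFun.comp (continuous_const_smul _)
  have hint (μ ν : Measure (EuclideanSpace ℝ (Fin d))) [IsProbabilityMeasure μ]
      [IsProbabilityMeasure ν] : Integrable (fun g ↦ ⟪charFun ν (√β • g), charFun μ (√β • g)⟫)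
        (stdGaussian (EuclideanSpace ℝ (Fin d))) :=
    Integrable.of_bound (C := 1) ((hc ν).inner (hc μ)).aestronglyMeasurable <|
      ae_of_all _ fun g ↦ (norm_inner_le_norm _ _).trans <|
        mul_le_one₀ (norm_charFun_le_one _) (norm_nonneg _) (norm_charFun_le_one _)
  have hexpand (g : EuclideanSpace ℝ (Fin d)) :
      ‖charFun μ₂ (√β • g) - charFun μ₁ (√β • g)‖ ^ 2 =
        ⟪charFun μ₁ (√β • g), charFun μ₁ (√β • g)⟫ + ⟪charFun μ₂ (√β • g), charFun μ₂ (√β • g)⟫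
          - 2 * ⟪charFun μ₂ (√β • g), charFun μ₁ (√β • g)⟫ := by
    rw [norm_sub_sq_real, real_inner_self_eq_norm_sq, real_inner_self_eq_norm_sq]
    ring
  have hdiff : Integrable (fun g ↦ ‖charFun μ₂ (√β • g) - charFun μ₁ (√β • g)‖ ^ 2)
      (stdGaussian (EuclideanSpace ℝ (Fin d))) := by
    simp_rw [hexpand]
    exact ((hint μ₁ μ₁).add (hint μ₂ μ₂)).sub ((hint μ₁ μ₂).const_mul 2)
  obtain ⟨t, ht⟩ : ∃ t, charFun μ₁ t ≠ charFun μ₂ t := by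
    by_contra! h
    exact hne (Measure.ext_of_charFun (funext h))
  have hpos : 0 < ∫ g, ‖charFun μ₂ (√β • g) - charFun μ₁ (√β • g)‖ ^ 2
      ∂(stdGaussian (EuclideanSpace ℝ (Fin d))) := by
    have := isOpenPosMeasure_stdGaussian (Fin d)
    have h1 := hc μ₁
    have h2 := hc μ₂
    refine integral_pos_of_integrable_nonneg_nonzero (x := (√β)⁻¹ • t) (by fun_prop) hdiff
      (fun g ↦ by positivity) ?_
    rw [smul_inv_smul₀ (Real.sqrt_pos.2 hβ).ne']
    exact pow_ne_zero 2 (norm_ne_zero_iff.2 (sub_ne_zero.2 ht.symm))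
  simp_rw [hexpand] at hpos
  rw [integral_sub (by exact (hint μ₁ μ₁).add (hint μ₂ μ₂)) ((hint μ₁ μ₂).const_mul 2),
    integral_add (hint μ₁ μ₁) (hint μ₂ μ₂), integral_const_mul] at hpos
  nlinarith [mul_pos (Real.exp_pos β) hpos]
end

section
/- Fix β > 0, K_β(θ) = exp(β cos θ), and θ_c(β) = arccos((√(1+4β²) − 1)/(2β)). For every λ ∈ (0,1) there exists β₀ = β₀(λ) > 0 such that for all β ≥ β₀(λ), sup over |θ| ≤ λ θ_c(β) of K_β''(θ) is at most −exp(−λ²/2) · ((1−λ²)/2) · β · exp(β). -/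
open Real

theorem iteratedDeriv_two_exp_mul_cos (β θ : ℝ) :
    iteratedDeriv 2 (fun t : ℝ => exp (β * cos t)) θ
      = -((β * cos θ - β ^ 2 * sin θ ^ 2) * exp (β * cos θ)) := by
  have hE (t : ℝ) : HasDerivAt (fun t => exp (β * cos t)) (exp (β * cos t) * (β * -sin t)) t :=
    ((hasDerivAt_cos t).const_mul β).exp
  have h1 : deriv (fun t : ℝ => exp (β * cos t)) = fun t => exp (β * cos t) * (β * -sin t) :=
    funext fun t => (hE t).deriv
  rw [iteratedDeriv_succ, iteratedDeriv_one, h1,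
    ((hE θ).fun_mul ((hasDerivAt_sin θ).fun_neg.const_mul β)).deriv]
  ring

/-- The concavity radius of `exp (β * cos θ)` is at most `1 / √β`. -/
theorem arccos_concavity_radius_le {β : ℝ} (hβ : 1 ≤ β) :
    arccos ((√(1 + 4 * β ^ 2) - 1) / (2 * β)) ≤ √β⁻¹ := by
  have hβ0 : 0 < β := by linarith
  have hinv : 0 < β⁻¹ := inv_pos.2 hβ0
  have hinv1 : β⁻¹ ≤ 1 := inv_le_one_of_one_le₀ hβ
  have hmul : β * β⁻¹ = 1 := mul_inv_cancel₀ hβ0.ne'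
  set x := √β⁻¹ with hx
  have hx0 : 0 ≤ x := sqrt_nonneg _
  have hx2 : x ^ 2 = β⁻¹ := sq_sqrt hinv.le
  have hx1 : x ≤ 1 := sqrt_le_one.2 hinv1
  have hcos : cos x ≤ 1 - β⁻¹ / 2 + β⁻¹ ^ 2 * (5 / 96) := by
    have h := (abs_le.1 (cos_bound (x := x) (by rwa [abs_of_nonneg hx0]))).2
    rw [abs_of_nonneg hx0, show x ^ 4 = (x ^ 2) ^ 2 by ring, hx2] at h
    linarith
  have hsqrt : 2 * β + 5 / 48 * β⁻¹ ≤ √(1 + 4 * β ^ 2) := by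
    apply le_sqrt_of_sq_le
    nlinarith
  have hle : cos x ≤ (√(1 + 4 * β ^ 2) - 1) / (2 * β) := by
    rw [le_div_iff₀ (by positivity)]
    calc cos x * (2 * β) ≤ (1 - β⁻¹ / 2 + β⁻¹ ^ 2 * (5 / 96)) * (2 * β) := by gcongr
      _ = 2 * β - (β * β⁻¹) + 5 / 48 * β⁻¹ * (β * β⁻¹) := by ring
      _ ≤ _ := by rw [hmul]; linarith
  calc _ ≤ arccos (cos x) := arccos_le_arccos hle
    _ = x := arccos_cos hx0 (by linarith [pi_gt_three])

/-- **Quantitative concavity bound inside the concavity radius** (Lemma on concavity,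
estimate `K_β'' ≤ -e^{-λ²/2} (1-λ²)/2 · β e^β` on `|θ| ≤ λ θ_c(β)` for `β` large). -/
theorem kernel_second_deriv_upper_bound_inside (lam : ℝ) (hlam : lam ∈ Set.Ioo (0 : ℝ) 1) :
    ∃ β₀ > (0 : ℝ), ∀ β ≥ β₀, ∀ θ : ℝ,
      |θ| ≤ lam * Real.arccos ((Real.sqrt (1 + 4 * β ^ 2) - 1) / (2 * β)) →
      iteratedDeriv 2 (fun t : ℝ => Real.exp (β * Real.cos t)) θ
        ≤ -(Real.exp (-(lam ^ 2) / 2) * ((1 - lam ^ 2) / 2) * β * Real.exp β) := by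
  obtain ⟨h0, h1⟩ := hlam
  have hgap : 0 < 1 - lam ^ 2 := by nlinarith
  refine ⟨max 1 (1 / (1 - lam ^ 2)), by positivity, fun β hβ θ hθ => ?_⟩
  have hβ1 : 1 ≤ β := (le_max_left _ _).trans hβ
  have hβ2 : 1 ≤ β * (1 - lam ^ 2) := (div_le_iff₀ hgap).1 ((le_max_right _ _).trans hβ)
  have hβ0 : 0 < β := by linarith
  have hθ' : |θ| ≤ lam * √β⁻¹ :=
    hθ.trans (mul_le_mul_of_nonneg_left (arccos_concavity_radius_le hβ1) h0.le)
  have hβθ : β * θ ^ 2 ≤ lam ^ 2 := by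
    calc β * θ ^ 2 = β * |θ| ^ 2 := by rw [sq_abs]
      _ ≤ β * (lam * √β⁻¹) ^ 2 := by gcongr
      _ = lam ^ 2 := by rw [mul_pow, sq_sqrt (by positivity)]; field_simp
  have hcos : 1 - θ ^ 2 / 2 ≤ cos θ := one_sub_sq_div_two_le_cos
  have hsin : sin θ ^ 2 ≤ θ ^ 2 := sq_le_sq.2 abs_sin_le_abs
  have hθsq : θ ^ 2 ≤ 1 - lam ^ 2 := by nlinarith
  have hfactor : (1 - lam ^ 2) / 2 * β ≤ β * cos θ - β ^ 2 * sin θ ^ 2 := by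
    have : (1 - lam ^ 2) / 2 ≤ cos θ - β * sin θ ^ 2 := by nlinarith
    nlinarith
  have hexp : exp (-(lam ^ 2) / 2) * exp β ≤ exp (β * cos θ) := by
    rw [← exp_add]
    apply exp_le_exp.2
    nlinarith
  rw [iteratedDeriv_two_exp_mul_cos]
  apply neg_le_neg
  calc _ = ((1 - lam ^ 2) / 2 * β) * (exp (-(lam ^ 2) / 2) * exp β) := by ring
    _ ≤ _ := mul_le_mul hfactor hexp (by positivity) ((by positivity : (0 : ℝ) ≤ _).trans hfactor)
end

section
/- Let d = 2 and β > 0. Let ω₁, ω₂ ∈ ℝ and a₁, a₂ ∈ ℝ² be perceptron weights with ReLU activation, and define the perceptron potential v(x) = Σ_{j=1}^{2} ω_j (max(⟨a_j, x⟩, 0))² for x ∈ S¹. Assume that the function θ ↦ v((cos θ, sin θ)) is not real-analytic on ℝ. Then any Borel probability measure μ on the unit circle S¹ ⊂ ℝ² satisfying the stationarity condition — for every x ∈ supp μ, the tangential component (I − x xᵀ)(∫ exp(β ⟨x,y⟩) y dμ(y) + Σ_{j=1}^{2} ω_j max(⟨a_j, x⟩, 0) a_j) equals 0 — is purely atomic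 and has finite support. -/
open MeasureTheory Real
open scoped RealInnerProductSpace ENNReal

/-- The point of the unit circle `S¹ ⊆ ℝ²` with angle `θ`. -/
noncomputable def circlePt (θ : ℝ) : EuclideanSpace ℝ (Fin 2) :=
  (WithLp.equiv 2 (Fin 2 → ℝ)).symm ![Real.cos θ, Real.sin θ]

/-- Orthogonal projection `(I - x xᵀ) v` onto the tangent space of the sphere at `x`. -/
noncomputable def tangentProj {d : ℕ} (x v : EuclideanSpace ℝ (Fin d)) :
    EuclideanSpace ℝ (Fin d) :=
  v - ⟪x, v⟫ • x

/-- Topological support of a measure. -/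
def measSupport {α : Type*} [TopologicalSpace α] [MeasurableSpace α]
    (μ : Measure α) : Set α :=
  {x | ∀ U : Set α, IsOpen U → x ∈ U → μ U ≠ 0}

theorem integral_cos_pow_succ_mul_cos (m : ℕ) (n : ℤ) :
    ∫ t in (0 : ℝ)..2 * π, cos t ^ (m + 1) * cos (n * t) =
      ((∫ t in (0 : ℝ)..2 * π, cos t ^ m * cos ((n + 1 : ℤ) * t)) +
        ∫ t in (0 : ℝ)..2 * π, cos t ^ m * cos ((n - 1 : ℤ) * t)) / 2 := by
  rw [← intervalIntegral.integral_add (Continuous.intervalIntegrable (by fun_prop) _ _)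
    (Continuous.intervalIntegrable (by fun_prop) _ _), ← intervalIntegral.integral_div]
  congr 1
  ext t
  push_cast
  rw [add_mul, sub_mul, one_mul, cos_add, cos_sub]
  ring

theorem integral_cos_pow_mul_cos_nonneg (m : ℕ) (n : ℤ) :
    0 ≤ ∫ t in (0 : ℝ)..2 * π, cos t ^ m * cos (n * t) := by
  induction m generalizing n with
  | zero =>
    rcases eq_or_ne n 0 with rfl | hn
    · simp [pi_pos.le]
    · have hn' : (n : ℝ) ≠ 0 := by exact_mod_cast hn
      have h : ∫ t in (0 : ℝ)..2 * π, cos (n * t) = 0 := by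
        rw [intervalIntegral.integral_comp_mul_left (fun t => cos t) hn', integral_cos]
        have h₂ : sin (n * (2 * π)) = 0 := by
          simpa [mul_assoc] using sin_int_mul_pi (n * 2)
        simp [h₂]
      simp [h]
  | succ m ih =>
    rw [integral_cos_pow_succ_mul_cos]
    have h₁ := ih (n + 1)
    have h₂ := ih (n - 1)
    positivity

theorem integral_cos_pow_mul_cos_pos (m : ℕ) :
    0 < ∫ t in (0 : ℝ)..2 * π, cos t ^ m * cos ((m : ℤ) * t) := by
  induction m with
  | zero => simp [pi_pos]
  | succ m ih =>
    have h := integral_cos_pow_succ_mul_cos m ((m + 1 : ℕ) : ℤ)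
    rw [h]
    have h₁ := integral_cos_pow_mul_cos_nonneg m (((m + 1 : ℕ) : ℤ) + 1)
    have h₂ : (((m + 1 : ℕ) : ℤ) - 1) = (m : ℤ) := by push_cast; ring
    rw [h₂]
    positivity

/-- The modified Bessel functions of integer order are positive on `(0, ∞)`. -/
theorem integral_exp_mul_cos_mul_cos_pos {β : ℝ} (hβ : 0 < β) (n : ℤ) :
    0 < ∫ t in (0 : ℝ)..2 * π, exp (β * cos t) * cos (n * t) := by
  have habs : ∀ t : ℝ, cos (n * t) = cos ((n.natAbs : ℤ) * t) := fun t => by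
    rcases Int.natAbs_eq n with h | h
    · rw [← h]
    · conv_lhs => rw [h]
      push_cast
      rw [neg_mul, cos_neg]
  simp_rw [habs]
  set k := n.natAbs
  have hsum : HasSum
      (fun m : ℕ => ∫ t in (0 : ℝ)..2 * π, (β * cos t) ^ m / m.factorial * cos ((k : ℤ) * t))
      (∫ t in (0 : ℝ)..2 * π, exp (β * cos t) * cos ((k : ℤ) * t)) := by
    refine intervalIntegral.hasSum_integral_of_dominated_convergence
      (fun m _ => β ^ m / m.factorial) (fun m => ?_) (fun m => ?_) ?_ ?_ ?_
    · exact Continuous.aestronglyMeasurable (by fun_prop)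
    · refine ae_of_all _ fun t _ => ?_
      rw [norm_mul, norm_div, norm_pow, norm_mul, Real.norm_of_nonneg hβ.le, RCLike.norm_natCast,
        mul_pow]
      have h₁ : ‖cos t‖ ^ m ≤ 1 := pow_le_one₀ (norm_nonneg _) (abs_cos_le_one t)
      have h₂ : ‖cos ((k : ℤ) * t)‖ ≤ 1 := abs_cos_le_one _
      calc β ^ m * ‖cos t‖ ^ m / m.factorial * ‖cos ((k : ℤ) * t)‖
          ≤ β ^ m * 1 / m.factorial * 1 := by gcongr
        _ = _ := by ring
    · exact ae_of_all _ fun t _ => summable_pow_div_factorial β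
    · exact intervalIntegrable_const
    · refine ae_of_all _ fun t _ => HasSum.mul_right _ ?_
      rw [exp_eq_exp_ℝ]
      exact NormedSpace.expSeries_div_hasSum_exp (β * cos t)
  have hterm : ∀ m : ℕ,
      ∫ t in (0 : ℝ)..2 * π, (β * cos t) ^ m / m.factorial * cos ((k : ℤ) * t) =
        β ^ m / m.factorial * ∫ t in (0 : ℝ)..2 * π, cos t ^ m * cos ((k : ℤ) * t) := fun m => by
    rw [← intervalIntegral.integral_const_mul]
    congr 1
    ext t
    rw [mul_pow]
    ring
  simp_rw [hterm] at hsum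
  rw [← hsum.tsum_eq]
  refine hsum.summable.tsum_pos (fun m => ?_) k ?_
  · exact mul_nonneg (by positivity) (integral_cos_pow_mul_cos_nonneg m k)
  · exact mul_pos (by positivity) (integral_cos_pow_mul_cos_pos k)

theorem integral_cexp_mul_cos_mul_cexp_ne_zero {β : ℝ} (hβ : 0 < β) (n : ℤ) :
    ∫ t in (0 : ℝ)..2 * π, Complex.exp (β * cos t) * Complex.exp (n * t * Complex.I) ≠ 0 := by
  intro h
  have hre := congrArg (Complex.reCLM : ℂ → ℝ) h
  rw [← ContinuousLinearMap.intervalIntegral_comp_comm _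
    (Continuous.intervalIntegrable (by fun_prop) _ _)] at hre
  refine (integral_exp_mul_cos_mul_cos_pos hβ n).ne' ?_
  rw [← Complex.zero_re, ← Complex.reCLM_apply, ← hre]
  congr 1
  ext t
  have h₁ : Complex.exp (β * cos t) = (exp (β * cos t) : ℝ) := by push_cast; rfl
  have h₂ : (n * t * Complex.I : ℂ) = ((n * t : ℝ) : ℂ) * Complex.I := by push_cast; rfl
  rw [Complex.reCLM_apply, h₁, h₂, Complex.re_ofReal_mul, Complex.exp_ofReal_mul_I_re]

/-- The potential `z ↦ ∫ exp (β cos (z - y)) dν y` is entire. -/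
theorem hasDerivAt_integral_cexp_mul_cos_sub (β : ℝ) (ν : Measure ℝ) [IsFiniteMeasure ν] (z : ℂ) :
    HasDerivAt (fun z : ℂ => ∫ y : ℝ, Complex.exp (β * Complex.cos (z - y)) ∂ν)
      (∫ y : ℝ, Complex.exp (β * Complex.cos (z - y)) * (β * -Complex.sin (z - y)) ∂ν) z := by
  have hexp : ∀ w ∈ Metric.ball z 1, ∀ y : ℝ,
      ‖Complex.exp ((w - y) * Complex.I)‖ ≤ exp (|z.im| + 1) ∧
      ‖Complex.exp (-(w - y) * Complex.I)‖ ≤ exp (|z.im| + 1) := by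
    intro w hw y
    have him : |w.im| ≤ |z.im| + 1 := by
      have h₁ : |(w - z).im| ≤ ‖w - z‖ := Complex.abs_im_le_norm _
      have h₂ : ‖w - z‖ < 1 := by simpa [dist_eq_norm] using hw
      have h₃ : w.im = z.im + (w - z).im := by simp
      rw [h₃]
      exact (abs_add_le _ _).trans (by linarith)
    have h₁ := neg_abs_le w.im
    have h₂ := le_abs_self w.im
    rw [Complex.norm_exp, Complex.norm_exp]
    constructor <;> refine exp_le_exp.2 ?_ <;> simp <;> linarith
  have hcos : ∀ w ∈ Metric.ball z 1, ∀ y : ℝ, ‖Complex.cos (w - y)‖ ≤ exp (|z.im| + 1) := by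
    intro w hw y
    obtain ⟨h₁, h₂⟩ := hexp w hw y
    rw [Complex.cos, norm_div, Complex.norm_two]
    have := norm_add_le (Complex.exp ((w - y) * Complex.I)) (Complex.exp (-(w - y) * Complex.I))
    linarith
  have hsin : ∀ w ∈ Metric.ball z 1, ∀ y : ℝ, ‖Complex.sin (w - y)‖ ≤ exp (|z.im| + 1) := by
    intro w hw y
    obtain ⟨h₁, h₂⟩ := hexp w hw y
    rw [Complex.sin, norm_div, Complex.norm_two, norm_mul, Complex.norm_I]
    have := norm_sub_le (Complex.exp (-(w - y) * Complex.I)) (Complex.exp ((w - y) * Complex.I))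
    linarith
  have hF : ∀ w ∈ Metric.ball z 1, ∀ y : ℝ,
      ‖Complex.exp (β * Complex.cos (w - y))‖ ≤ exp (|β| * exp (|z.im| + 1)) := by
    intro w hw y
    refine (Complex.norm_exp_le_exp_norm _).trans (exp_le_exp.2 ?_)
    rw [norm_mul, Complex.norm_real, Real.norm_eq_abs]
    gcongr
    exact hcos w hw y
  have hmeas : ∀ w : ℂ,
      AEStronglyMeasurable (fun y : ℝ => Complex.exp (β * Complex.cos (w - y))) ν := fun w =>
    Continuous.aestronglyMeasurable (by fun_prop)
  have hz : z ∈ Metric.ball z 1 := Metric.mem_ball_self one_pos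
  refine (hasDerivAt_integral_of_dominated_loc_of_deriv_le (s := Metric.ball z 1)
    (bound := fun _ => exp (|β| * exp (|z.im| + 1)) * (|β| * exp (|z.im| + 1)))
    (F := fun (w : ℂ) (y : ℝ) => Complex.exp (β * Complex.cos (w - y)))
    (F' := fun (w : ℂ) (y : ℝ) =>
      Complex.exp (β * Complex.cos (w - y)) * (β * -Complex.sin (w - y)))
    (Metric.ball_mem_nhds z one_pos) (.of_forall hmeas) ?_ ?_ ?_ ?_ ?_).2
  · exact Integrable.of_bound (hmeas z) _ (ae_of_all _ (hF z hz))
  · exact Continuous.aestronglyMeasurable (by fun_prop)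
  · refine ae_of_all _ fun y w hw => ?_
    rw [norm_mul, norm_mul, norm_neg, Complex.norm_real, Real.norm_eq_abs]
    gcongr
    · exact hF w hw y
    · exact hsin w hw y
  · exact integrable_const _
  · refine ae_of_all _ fun y w _ => ?_
    have h := ((Complex.hasDerivAt_cos (w - y)).comp w ((hasDerivAt_id w).sub_const (y : ℂ)))
    rw [mul_one] at h
    exact (h.const_mul (β : ℂ)).cexp

/-- The potential on the circle, in angular coordinates, generated by the kernel `exp (β ⟨x, y⟩)`
and a measure `ν` on angles. -/
noncomputable def circlePotential (β : ℝ) (ν : Measure ℝ) (θ : ℝ) : ℝ :=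
  ∫ y, exp (β * cos (θ - y)) ∂ν

theorem ofReal_circlePotential (β : ℝ) (ν : Measure ℝ) (θ : ℝ) :
    (circlePotential β ν θ : ℂ) = ∫ y : ℝ, Complex.exp (β * Complex.cos (θ - y)) ∂ν := by
  rw [circlePotential, ← integral_complex_ofReal]
  push_cast
  rfl

theorem hasDerivAt_circlePotential (β : ℝ) (ν : Measure ℝ) [IsFiniteMeasure ν] (θ : ℝ) :
    HasDerivAt (circlePotential β ν) (β * ∫ y, exp (β * cos (θ - y)) * sin (y - θ) ∂ν) θ := by
  have h := (hasDerivAt_integral_cexp_mul_cos_sub β ν θ).real_of_complex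
  convert h using 1
  · ext t
    rw [← ofReal_circlePotential, Complex.ofReal_re]
  · rw [← Complex.ofReal_re (β * _), ← integral_const_mul, ← integral_complex_ofReal]
    congr 2
    ext y
    rw [← neg_sub θ y, sin_neg]
    push_cast
    ring

theorem analyticAt_circlePotential (β : ℝ) (ν : Measure ℝ) [IsFiniteMeasure ν] (θ : ℝ) :
    AnalyticAt ℝ (circlePotential β ν) θ := by
  have hd : Differentiable ℂ (fun z : ℂ => ∫ y : ℝ, Complex.exp (β * Complex.cos (z - y)) ∂ν) :=
    fun z => (hasDerivAt_integral_cexp_mul_cos_sub β ν z).differentiableAt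
  have h := (hd.analyticAt (θ : ℂ)).re_ofReal
  convert h using 1
  ext t
  rw [← ofReal_circlePotential, Complex.ofReal_re]

theorem integral_cexp_int_mul_I_eq_zero {n : ℤ} (hn : n ≠ 0) :
    ∫ t in (0 : ℝ)..2 * π, Complex.exp (n * t * Complex.I) = 0 := by
  have hn' : (n : ℂ) * Complex.I ≠ 0 := mul_ne_zero (by exact_mod_cast hn) Complex.I_ne_zero
  have h := integral_exp_mul_complex (a := 0) (b := 2 * π) hn'
  have h₁ : Complex.exp (n * Complex.I * (2 * π : ℝ)) = 1 := by
    rw [← Complex.exp_int_mul_two_pi_mul_I n]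
    congr 1
    push_cast
    ring
  rw [h₁] at h
  simp only [Complex.ofReal_zero, mul_zero, Complex.exp_zero, sub_self, zero_div] at h
  rw [← h]
  congr 1
  ext t
  ring_nf

theorem integral_cexp_mul_cos_sub_mul_cexp (β : ℝ) (n : ℤ) (y : ℝ) :
    ∫ t in (0 : ℝ)..2 * π, Complex.exp (β * Complex.cos (t - y)) * Complex.exp (n * t * Complex.I) =
      Complex.exp (n * y * Complex.I) *
        ∫ t in (0 : ℝ)..2 * π, Complex.exp (β * cos t) * Complex.exp (n * t * Complex.I) := by
  set f : ℝ → ℂ := fun t => Complex.exp (β * cos t) * Complex.exp (n * t * Complex.I) with hf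
  have hper : Function.Periodic f (2 * π) := fun t => by
    have h : Complex.exp (n * (t + 2 * π : ℝ) * Complex.I) = Complex.exp (n * t * Complex.I) := by
      rw [Complex.exp_eq_exp_iff_exists_int]
      exact ⟨n, by push_cast; ring⟩
    simp only [hf, cos_add_two_pi, h]
  have h₁ := hper.intervalIntegral_add_eq (-y) 0
  have h₂ := intervalIntegral.integral_comp_sub_right (a := 0) (b := 2 * π) f y
  rw [zero_sub, show 2 * π - y = -y + 2 * π by ring, h₁, zero_add] at h₂
  rw [← h₂, ← intervalIntegral.integral_const_mul]
  congr 1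
  ext t
  rw [hf]
  simp only
  rw [mul_left_comm, ← Complex.exp_add (n * y * Complex.I)]
  push_cast
  congr 2
  ring

theorem integral_circlePotential_mul_cexp (β : ℝ) (ν : Measure ℝ) [IsFiniteMeasure ν] (n : ℤ) :
    ∫ t in (0 : ℝ)..2 * π, (circlePotential β ν t : ℂ) * Complex.exp (n * t * Complex.I) =
      (∫ y : ℝ, Complex.exp (n * y * Complex.I) ∂ν) *
        ∫ t in (0 : ℝ)..2 * π, Complex.exp (β * cos t) * Complex.exp (n * t * Complex.I) := by
  simp_rw [ofReal_circlePotential, ← integral_mul_const]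
  rw [intervalIntegral_integral_swap]
  · simp_rw [integral_cexp_mul_cos_sub_mul_cexp]
  · have : IsFiniteMeasure (volume.restrict (Set.uIoc 0 (2 * π))) := by
      rw [Set.uIoc]
      infer_instance
    refine Integrable.of_bound (C := exp |β|) (Continuous.aestronglyMeasurable ?_)
      (ae_of_all _ fun p => ?_)
    · simp only [Function.uncurry_def]
      fun_prop
    · have h₁ : (n * p.1 * Complex.I : ℂ) = ((n * p.1 : ℝ) : ℂ) * Complex.I := by push_cast; rfl
      have h₂ : (β * Complex.cos (p.1 - p.2) : ℂ) = ((β * cos (p.1 - p.2) : ℝ) : ℂ) := by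
        push_cast; rfl
      simp only [Function.uncurry_def]
      rw [norm_mul, h₁, Complex.norm_exp_ofReal_mul_I, mul_one, h₂, Complex.norm_exp,
        Complex.ofReal_re, exp_le_exp]
      refine (le_abs_self _).trans ?_
      rw [abs_mul]
      exact mul_le_of_le_one_right (abs_nonneg _) (abs_cos_le_one _)

theorem integral_cexp_eq_zero_of_circlePotential_eq {β : ℝ} (hβ : 0 < β) (ν : Measure ℝ)
    [IsFiniteMeasure ν] {c₀ c₁ c₂ : ℝ}
    (hW : ∀ θ, circlePotential β ν θ = c₀ + c₁ * cos (2 * θ) + c₂ * sin (2 * θ))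
    {n : ℤ} (h₀ : n ≠ 0) (h₁ : n ≠ 2) (h₂ : n ≠ -2) :
    ∫ y : ℝ, Complex.exp (n * y * Complex.I) ∂ν = 0 := by
  have h := integral_circlePotential_mul_cexp β ν n
  have hexp : ∀ t : ℝ, (circlePotential β ν t : ℂ) * Complex.exp (n * t * Complex.I) =
      c₀ * Complex.exp (n * t * Complex.I) +
      (c₁ - c₂ * Complex.I) / 2 * Complex.exp ((n + 2 : ℤ) * t * Complex.I) +
      (c₁ + c₂ * Complex.I) / 2 * Complex.exp ((n - 2 : ℤ) * t * Complex.I) := fun t => by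
    have e₁ : ((n + 2 : ℤ) * t * Complex.I : ℂ) = n * t * Complex.I + (2 * t) * Complex.I := by
      push_cast; ring
    have e₂ : ((n - 2 : ℤ) * t * Complex.I : ℂ) = n * t * Complex.I + (-(2 * t)) * Complex.I := by
      push_cast; ring
    rw [e₁, e₂, Complex.exp_add, Complex.exp_add, Complex.exp_mul_I (2 * t),
      Complex.exp_mul_I (-(2 * t)), Complex.cos_neg, Complex.sin_neg, hW]
    push_cast
    linear_combination (c₂ * Complex.sin (2 * t) * Complex.exp (n * t * Complex.I)) *
      Complex.I_sq
  have hint : ∀ (c : ℂ) (m : ℤ), IntervalIntegrable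
      (fun t : ℝ => c * Complex.exp (m * t * Complex.I)) volume 0 (2 * π) := fun c m =>
    Continuous.intervalIntegrable (by fun_prop) _ _
  simp_rw [hexp] at h
  rw [intervalIntegral.integral_add ((hint _ _).add (hint _ _)) (hint _ _),
    intervalIntegral.integral_add (hint _ _) (hint _ _),
    intervalIntegral.integral_const_mul, intervalIntegral.integral_const_mul,
    intervalIntegral.integral_const_mul, integral_cexp_int_mul_I_eq_zero h₀,
    integral_cexp_int_mul_I_eq_zero (by omega), integral_cexp_int_mul_I_eq_zero (by omega)] at h
  simp only [mul_zero, add_zero] at h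
  exact (mul_eq_zero.1 h.symm).resolve_right (integral_cexp_mul_cos_mul_cexp_ne_zero hβ n)

theorem continuous_circlePt : Continuous circlePt := by
  unfold circlePt
  simp only [WithLp.equiv_symm_apply]
  refine (PiLp.continuous_toLp 2 _).comp (continuous_pi fun i => ?_)
  fin_cases i
  · exact continuous_cos
  · exact continuous_sin

/-- Integration against a finite measure as a continuous linear functional on `C(X, ℂ)`. -/
noncomputable def integralFunctional {X : Type*} [TopologicalSpace X] [CompactSpace X]
    [MeasurableSpace X] [BorelSpace X] (ν : Measure X) [IsFiniteMeasure ν] : C(X, ℂ) →L[ℂ] ℂ :=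
  LinearMap.mkContinuous
    { toFun := fun f => ∫ x, f x ∂ν
      map_add' := fun f g =>
        integral_add (f.continuous.integrable_of_hasCompactSupport (.of_compactSpace _))
          (g.continuous.integrable_of_hasCompactSupport (.of_compactSpace _))
      map_smul' := fun c f => integral_const_mul c _ }
    (ν.real Set.univ) fun f => by
      rw [mul_comm]
      exact norm_integral_le_of_norm_le_const (ae_of_all _ f.norm_coe_le_norm)

theorem integralFunctional_apply {X : Type*} [TopologicalSpace X] [CompactSpace X]
    [MeasurableSpace X] [BorelSpace X] (ν : Measure X) [IsFiniteMeasure ν] (f : C(X, ℂ)) :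
    integralFunctional ν f = ∫ x, f x ∂ν := rfl

/-- If the Fourier coefficients of a probability measure vanish outside the modes `0, ±2`, then
its second-order difference tuned to annihilate the modes `±2` is a multiple of Haar measure. -/
theorem integral_add_sub_eq_of_fourier [Fact (0 < 2 * π)] (ν : Measure ℝ) [IsProbabilityMeasure ν]
    (hν : ∀ n : ℤ, n ≠ 0 → n ≠ 2 → n ≠ -2 → ∫ y : ℝ, Complex.exp (n * y * Complex.I) ∂ν = 0)
    (h : ℝ) (f : C(AddCircle (2 * π), ℂ)) :
    (∫ y : ℝ, f ((y + h : ℝ) : AddCircle (2 * π)) ∂ν) +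
        (∫ y : ℝ, f ((y - h : ℝ) : AddCircle (2 * π)) ∂ν) -
        2 * cos (2 * h) * ∫ y : ℝ, f (y : AddCircle (2 * π)) ∂ν =
      (2 - 2 * cos (2 * h)) * ∫ t, f t ∂AddCircle.haarAddCircle := by
  let T (s : ℝ) : ℝ → AddCircle (2 * π) := fun y => ((y + s : ℝ) : AddCircle (2 * π))
  have hT : ∀ s, Measurable (T s) := fun s =>
    ((AddCircle.continuous_mk' (2 * π)).comp (continuous_id.add continuous_const)).measurable
  have hprob : ∀ s, IsProbabilityMeasure (ν.map (T s)) := fun s =>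
    Measure.isProbabilityMeasure_map (hT s).aemeasurable
  have hmap : ∀ s (g : C(AddCircle (2 * π), ℂ)),
      integralFunctional (ν.map (T s)) g = ∫ y : ℝ, g (T s y) ∂ν := fun s g =>
    integral_map (hT s).aemeasurable g.continuous.aestronglyMeasurable
  have hfou : ∀ s (n : ℤ), integralFunctional (ν.map (T s)) (fourier n) =
      Complex.exp (n * s * Complex.I) * ∫ y : ℝ, Complex.exp (n * y * Complex.I) ∂ν := by
    intro s n
    rw [hmap, ← integral_const_mul]
    congr 1
    ext y
    have hπ : (π : ℂ) ≠ 0 := by exact_mod_cast pi_ne_zero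
    rw [fourier_coe_apply, ← Complex.exp_add]
    congr 1
    push_cast
    field_simp
    ring
  have key : integralFunctional (ν.map (T h)) + integralFunctional (ν.map (T (-h))) -
      (2 * cos (2 * h) : ℂ) • integralFunctional (ν.map (T 0)) =
      (2 - 2 * cos (2 * h) : ℂ) •
        integralFunctional (AddCircle.haarAddCircle (T := 2 * π)) := by
    refine ContinuousLinearMap.ext_on (s := Set.range (fourier (T := 2 * π))) ?_ ?_
    · rw [Submodule.dense_iff_topologicalClosure_eq_top]
      exact span_fourier_closure_eq_top
    · rintro _ ⟨n, rfl⟩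
      simp only [sub_apply, add_apply,
        smul_apply, hfou, smul_eq_mul]
      rcases eq_or_ne n 0 with rfl | h₀
      · simp [integralFunctional_apply]
        norm_num
      have hhaar : integralFunctional (AddCircle.haarAddCircle (T := 2 * π)) (fourier n) = 0 :=
        integral_eq_zero_of_add_right_eq_neg (fourier_add_half_inv_index h₀ (Fact.out))
      rw [hhaar, mul_zero]
      by_cases h₂ : n = 2 ∨ n = -2
      · have hc : Complex.exp (n * h * Complex.I) + Complex.exp (n * (-h : ℝ) * Complex.I) =
            2 * cos (2 * h) := by
          push_cast
          rw [Complex.cos]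
          rcases h₂ with rfl | rfl <;> push_cast <;> ring_nf
        rw [← add_mul, hc]
        simp
      · rw [not_or] at h₂
        simp [hν n h₀ h₂.1 h₂.2]
  have := congrArg (fun L => L f) key
  simp only [sub_apply, add_apply,
    smul_apply, hmap, smul_eq_mul, integralFunctional_apply] at this
  simpa [T, sub_eq_add_neg] using this

theorem measure_preimage_circlePt_ne_zero {β : ℝ} (hβ : 0 < β) (ν : Measure ℝ)
    [IsProbabilityMeasure ν] {c₀ c₁ c₂ : ℝ}
    (hW : ∀ θ, circlePotential β ν θ = c₀ + c₁ * cos (2 * θ) + c₂ * sin (2 * θ))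
    {U : Set (EuclideanSpace ℝ (Fin 2))} (hU : IsOpen U) {θ₀ : ℝ} (hθ₀ : circlePt θ₀ ∈ U) :
    ν (circlePt ⁻¹' U) ≠ 0 := by
  intro hzero
  have : Fact (0 < 2 * π) := ⟨two_pi_pos⟩
  obtain ⟨ε, hε, hball⟩ := Metric.isOpen_iff.1 (hU.preimage continuous_circlePt) θ₀ hθ₀
  set r := min ε 1 with hr
  have hr₀ : 0 < r := lt_min hε one_pos
  have hmem : ∀ y : ℝ, ‖((y - θ₀ : ℝ) : AddCircle (2 * π))‖ < r → y ∈ circlePt ⁻¹' U := by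
    intro y hy
    rw [AddCircle.norm_eq] at hy
    set k := round ((2 * π)⁻¹ * (y - θ₀))
    have h₁ : y - k * (2 * π) ∈ circlePt ⁻¹' U := hball <| by
      rw [Metric.mem_ball, Real.dist_eq, sub_right_comm]
      exact hy.trans_le (min_le_left _ _)
    have h₂ : circlePt (y - k * (2 * π)) = circlePt y := by
      simp [circlePt, cos_sub_int_mul_two_pi, sin_sub_int_mul_two_pi]
    rwa [Set.mem_preimage, h₂] at h₁
  let g : AddCircle (2 * π) → ℝ := fun t => max (r / 2 - ‖t - (θ₀ : AddCircle (2 * π))‖) 0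
  have hg : Continuous g := by fun_prop
  let f : C(AddCircle (2 * π), ℂ) := ⟨fun t => (g t : ℂ), by fun_prop⟩
  have hvanish : ∀ s : ℝ, |s| ≤ r / 2 →
      ∫ y : ℝ, f ((y + s : ℝ) : AddCircle (2 * π)) ∂ν = 0 := by
    intro s hs
    refine integral_eq_zero_of_ae ?_
    have hae : ∀ᵐ y ∂ν, y ∉ circlePt ⁻¹' U := measure_eq_zero_iff_ae_notMem.1 hzero
    filter_upwards [hae] with y hy
    have hle : r / 2 ≤ ‖((y + s : ℝ) : AddCircle (2 * π)) - (θ₀ : AddCircle (2 * π))‖ := by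
      by_contra! hlt
      refine hy (hmem y ?_)
      have e : ((y - θ₀ : ℝ) : AddCircle (2 * π)) =
          (((y + s : ℝ) : AddCircle (2 * π)) - (θ₀ : AddCircle (2 * π))) -
            ((s : ℝ) : AddCircle (2 * π)) := by
        rw [← AddCircle.coe_sub, ← AddCircle.coe_sub]
        congr 1
        ring
      have hs' : ‖((s : ℝ) : AddCircle (2 * π))‖ ≤ |s| := QuotientAddGroup.norm_mk_le_norm
      rw [e]
      refine (norm_sub_le _ _).trans_lt ?_
      linarith
    have hg0 : g ((y + s : ℝ) : AddCircle (2 * π)) = 0 := max_eq_right (by linarith)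
    change ((g ((y + s : ℝ) : AddCircle (2 * π)) : ℝ) : ℂ) = 0
    rw [hg0, Complex.ofReal_zero]
  have hid := integral_add_sub_eq_of_fourier ν
    (fun n => integral_cexp_eq_zero_of_circlePotential_eq hβ ν hW) (r / 2) f
  have e₁ := hvanish (r / 2) (abs_of_pos (by positivity)).le
  have e₂ := hvanish (-(r / 2)) (by rw [abs_neg, abs_of_pos (by positivity)])
  have e₃ := hvanish 0 (by rw [abs_zero]; positivity)
  simp only [add_zero, ← sub_eq_add_neg] at e₂ e₃
  rw [e₁, e₂, e₃, show 2 * (r / 2) = r by ring] at hid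
  have hf : ∫ t, f t ∂AddCircle.haarAddCircle =
      ((∫ t, g t ∂AddCircle.haarAddCircle : ℝ) : ℂ) := integral_complex_ofReal
  have hpos : 0 < ∫ t, g t ∂AddCircle.haarAddCircle := by
    refine hg.integral_pos_of_hasCompactSupport_nonneg_nonzero (.of_compactSpace _)
      (fun t => le_max_right _ _) (x := (θ₀ : AddCircle (2 * π))) ?_
    simp [g, hr₀]
  have hcos : cos r < 1 := by
    have := cos_lt_cos_of_nonneg_of_le_pi_div_two le_rfl
      ((min_le_right ε 1).trans (by linarith [pi_gt_three])) hr₀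
    rwa [cos_zero] at this
  rw [hf] at hid
  norm_cast at hid
  have : 0 < (2 - 2 * cos r) * ∫ t, g t ∂AddCircle.haarAddCircle :=
    mul_pos (by linarith) hpos
  simp at hid
  rcases hid with hid | hid <;> linarith

theorem inner_circlePt (v : EuclideanSpace ℝ (Fin 2)) (θ : ℝ) :
    ⟪v, circlePt θ⟫ = v 0 * cos θ + v 1 * sin θ := by
  simp [circlePt, PiLp.inner_apply, Fin.sum_univ_two, mul_comm]

theorem inner_circlePt_circlePt (s t : ℝ) : ⟪circlePt s, circlePt t⟫ = cos (s - t) := by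
  rw [inner_circlePt, cos_sub]
  simp [circlePt]

theorem hasDerivAt_inner_circlePt (v : EuclideanSpace ℝ (Fin 2)) (θ : ℝ) :
    HasDerivAt (fun θ => ⟪v, circlePt θ⟫) ⟪v, circlePt (θ + π / 2)⟫ θ := by
  simp only [inner_circlePt, cos_add_pi_div_two, sin_add_pi_div_two]
  exact ((hasDerivAt_cos θ).const_mul _).add ((hasDerivAt_sin θ).const_mul _)

theorem analyticAt_inner_circlePt (v : EuclideanSpace ℝ (Fin 2)) (θ : ℝ) :
    AnalyticAt ℝ (fun θ => ⟪v, circlePt θ⟫) θ := by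
  simp only [inner_circlePt]
  fun_prop

/-- The polar angle of a point of the plane. -/
noncomputable def polarAngle (x : EuclideanSpace ℝ (Fin 2)) : ℝ := Complex.arg ⟨x 0, x 1⟩

theorem measurable_polarAngle : Measurable polarAngle := by
  have h : Continuous fun x : EuclideanSpace ℝ (Fin 2) => (⟨x 0, x 1⟩ : ℂ) := by
    have e : (fun x : EuclideanSpace ℝ (Fin 2) => (⟨x 0, x 1⟩ : ℂ)) =
        fun x => (x 0 : ℂ) + (x 1 : ℂ) * Complex.I := by
      ext x
      exact Complex.mk_eq_add_mul_I _ _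
    rw [e]
    fun_prop
  exact Complex.measurable_arg.comp h.measurable

theorem circlePt_polarAngle {x : EuclideanSpace ℝ (Fin 2)}
    (hx : x ∈ Metric.sphere (0 : EuclideanSpace ℝ (Fin 2)) 1) : circlePt (polarAngle x) = x := by
  have hn : ‖(⟨x 0, x 1⟩ : ℂ)‖ = 1 := by
    rw [mem_sphere_zero_iff_norm, EuclideanSpace.norm_eq, Fin.sum_univ_two] at hx
    rw [Complex.norm_eq_sqrt_sq_add_sq]
    simpa using hx
  have h₀ : (⟨x 0, x 1⟩ : ℂ) ≠ 0 := norm_ne_zero_iff.1 (by rw [hn]; exact one_ne_zero)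
  ext i
  fin_cases i
  · simp [circlePt, polarAngle, Complex.cos_arg h₀, hn]
  · simp [circlePt, polarAngle, Complex.sin_arg, hn]

theorem integral_map_polarAngle {E : Type*} [NormedAddCommGroup E] [NormedSpace ℝ E]
    {μ : Measure (EuclideanSpace ℝ (Fin 2))}
    (hs : μ (Metric.sphere (0 : EuclideanSpace ℝ (Fin 2)) 1)ᶜ = 0)
    {F : EuclideanSpace ℝ (Fin 2) → E} (hF : Continuous F) :
    ∫ t, F (circlePt t) ∂(μ.map polarAngle) = ∫ x, F x ∂μ := by
  rw [integral_map (f := fun t => F (circlePt t)) measurable_polarAngle.aemeasurable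
    (hF.comp continuous_circlePt).aestronglyMeasurable]
  refine integral_congr_ae ?_
  filter_upwards [measure_eq_zero_iff_ae_notMem.1 hs] with x hx
  rw [circlePt_polarAngle (Set.notMem_compl_iff.1 hx)]

theorem hasDerivAt_max_zero_sq (u : ℝ) : HasDerivAt (fun u : ℝ => max u 0 ^ 2) (2 * max u 0) u := by
  rcases lt_trichotomy u 0 with hu | rfl | hu
  · rw [max_eq_right hu.le, mul_zero]
    refine (hasDerivAt_const u (0 : ℝ)).congr_of_eventuallyEq ?_
    filter_upwards [gt_mem_nhds hu] with w hw
    simp [max_eq_right hw.le]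
  · have h : (fun u : ℝ => max u 0 ^ 2) =O[nhds 0] fun u : ℝ => ‖u - 0‖ ^ 2 := by
      refine Asymptotics.IsBigO.of_bound 1 (.of_forall fun u => ?_)
      rw [norm_pow, norm_pow, norm_norm, sub_zero, one_mul]
      gcongr
      rcases le_total u 0 with h | h <;> simp [h]
    simpa using (h.hasFDerivAt one_lt_two).hasDerivAt
  · rw [max_eq_left hu.le]
    have h : HasDerivAt (fun w : ℝ => w ^ 2) (2 * u) u := by simpa using hasDerivAt_pow 2 u
    refine h.congr_of_eventuallyEq ?_
    filter_upwards [lt_mem_nhds hu] with w hw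
    simp [max_eq_left hw.le]

/-- The stationarity condition in angular coordinates. -/
theorem stationary_angular {ι : Type*} [Fintype ι] {β : ℝ} {ω : ι → ℝ}
    {a : ι → EuclideanSpace ℝ (Fin 2)} {μ : Measure (EuclideanSpace ℝ (Fin 2))}
    [IsFiniteMeasure μ] (hs : μ (Metric.sphere (0 : EuclideanSpace ℝ (Fin 2)) 1)ᶜ = 0) {θ : ℝ}
    (hθ : tangentProj (circlePt θ) ((∫ y, Real.exp (β * ⟪circlePt θ, y⟫) • y ∂μ)
        + ∑ j, (ω j * max ⟪a j, circlePt θ⟫ 0) • a j) = 0) :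
    (∫ y, exp (β * cos (θ - y)) * sin (y - θ) ∂(μ.map polarAngle)) +
      ∑ j, ω j * max ⟪a j, circlePt θ⟫ 0 * ⟪a j, circlePt (θ + π / 2)⟫ = 0 := by
  have horth : ⟪circlePt (θ + π / 2), circlePt θ⟫ = 0 := by
    rw [inner_circlePt_circlePt, add_sub_cancel_left, cos_pi_div_two]
  have h := congrArg (fun w => ⟪circlePt (θ + π / 2), w⟫) hθ
  simp only [tangentProj, inner_sub_right, inner_smul_right, horth, mul_zero, sub_zero,
    inner_add_right, inner_zero_right, inner_sum] at h
  have hcont : Continuous fun y : EuclideanSpace ℝ (Fin 2) =>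
      Real.exp (β * ⟪circlePt θ, y⟫) • y := by fun_prop
  have hint : Integrable (fun t => Real.exp (β * ⟪circlePt θ, circlePt t⟫) • circlePt t)
      (μ.map polarAngle) := by
    refine Integrable.of_bound (C := exp |β|)
      (hcont.comp continuous_circlePt).aestronglyMeasurable (ae_of_all _ fun t => ?_)
    have hn : ‖circlePt t‖ = 1 := by
      rw [norm_eq_sqrt_real_inner, inner_circlePt_circlePt, sub_self, cos_zero, sqrt_one]
    rw [norm_smul, hn, mul_one, Real.norm_eq_abs, abs_exp, exp_le_exp, inner_circlePt_circlePt]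
    refine (le_abs_self _).trans ?_
    rw [abs_mul]
    exact mul_le_of_le_one_right (abs_nonneg _) (abs_cos_le_one _)
  rw [← integral_map_polarAngle hs hcont, ← integral_inner hint] at h
  refine Eq.trans ?_ h
  congr 1
  · congr 1
    ext y
    rw [inner_smul_right, inner_circlePt_circlePt, inner_circlePt_circlePt,
      show θ + π / 2 - y = π / 2 - (y - θ) by ring, cos_pi_div_two_sub]
  · simp only [real_inner_comm]

/-- An analytic function on `ℝ` with infinitely many zeros in a compact set vanishes. -/
theorem eq_zero_of_infinite_zeros {f : ℝ → ℝ} (hf : ∀ t, AnalyticAt ℝ f t) {Z K : Set ℝ}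
    (hK : IsCompact K) (hZK : Z ⊆ K) (hZ : Z.Infinite) (hfZ : ∀ t ∈ Z, f t = 0) (t : ℝ) :
    f t = 0 := by
  obtain ⟨z, -, hz⟩ := hZ.exists_accPt_of_subset_isCompact hK hZK
  have hfreq := (accPt_iff_frequently_nhdsNE.1 hz).mono hfZ
  have hA : AnalyticOnNhd ℝ f Set.univ := fun t _ => hf t
  exact hA.eqOn_zero_of_preconnected_of_frequently_eq_zero isPreconnected_univ
    (Set.mem_univ z) hfreq (Set.mem_univ t)

theorem circlePt_mem_measSupport_of_infinite {ι : Type*} [Fintype ι] {β : ℝ} (hβ : 0 < β)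
    (ω : ι → ℝ) (a : ι → EuclideanSpace ℝ (Fin 2))
    (μ : Measure (EuclideanSpace ℝ (Fin 2))) [IsProbabilityMeasure μ]
    (hs : μ (Metric.sphere (0 : EuclideanSpace ℝ (Fin 2)) 1)ᶜ = 0)
    (hstat : ∀ x ∈ measSupport μ,
      tangentProj x ((∫ y, Real.exp (β * ⟪x, y⟫) • y ∂μ)
        + ∑ j, (ω j * max ⟪a j, x⟫ 0) • a j) = 0)
    (hinf : (measSupport μ).Infinite) (θ₀ : ℝ) : circlePt θ₀ ∈ measSupport μ := by
  classical
  set ν := μ.map polarAngle with hν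
  have : IsProbabilityMeasure ν :=
    Measure.isProbabilityMeasure_map measurable_polarAngle.aemeasurable
  have hsub : measSupport μ ⊆ Metric.sphere (0 : EuclideanSpace ℝ (Fin 2)) 1 := by
    intro x hx
    by_contra hxs
    exact hx _ Metric.isClosed_sphere.isOpen_compl hxs hs
  have hinj : Set.InjOn polarAngle (measSupport μ) := fun x hx y hy hxy => by
    rw [← circlePt_polarAngle (hsub hx), hxy, circlePt_polarAngle (hsub hy)]
  set Z := polarAngle '' measSupport μ with hZ
  have hZinf : Z.Infinite := hinf.image hinj
  have hZsupp : ∀ θ ∈ Z, circlePt θ ∈ measSupport μ := by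
    rintro _ ⟨x, hx, rfl⟩
    rwa [circlePt_polarAngle (hsub hx)]
  let Zs : Finset ι → Set ℝ := fun J => {θ ∈ Z | ∀ j, j ∈ J ↔ 0 ≤ ⟪a j, circlePt θ⟫}
  have hcover : Z ⊆ ⋃ J, Zs J := fun θ hθ =>
    Set.mem_iUnion.2 ⟨Finset.univ.filter fun j => 0 ≤ ⟪a j, circlePt θ⟫, hθ, fun j => by simp⟩
  obtain ⟨J, hJ⟩ : ∃ J, (Zs J).Infinite := by
    by_contra! hfin
    exact hZinf ((Set.finite_iUnion fun J => hfin J).subset hcover)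
  let P : ℝ → ℝ := fun θ => circlePotential β ν θ + β / 2 * ∑ j ∈ J, ω j * ⟪a j, circlePt θ⟫ ^ 2
  have hP : ∀ θ, HasDerivAt P (β * (∫ y, exp (β * cos (θ - y)) * sin (y - θ) ∂ν) +
      β / 2 * ∑ j ∈ J, ω j * (2 * ⟪a j, circlePt θ⟫ * ⟪a j, circlePt (θ + π / 2)⟫)) θ := by
    intro θ
    refine (hasDerivAt_circlePotential β ν θ).add (HasDerivAt.const_mul _ ?_)
    refine HasDerivAt.fun_sum fun j _ => HasDerivAt.const_mul _ ?_
    simpa using (hasDerivAt_inner_circlePt (a j) θ).fun_pow 2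
  have hPan : ∀ θ, AnalyticAt ℝ P θ := fun θ =>
    (analyticAt_circlePotential β ν θ).add (analyticAt_const.mul
      (Finset.analyticAt_fun_sum _ fun j _ =>
        analyticAt_const.mul ((analyticAt_inner_circlePt (a j) θ).pow 2)))
  have hP₀ : ∀ θ, deriv P θ = 0 := by
    refine eq_zero_of_infinite_zeros (fun θ => (hPan θ).deriv) (Z := Zs J)
      (isCompact_Icc (a := -π) (b := π)) ?_ hJ ?_
    · rintro _ ⟨⟨x, -, rfl⟩, -⟩
      exact ⟨(Complex.neg_pi_lt_arg _).le, Complex.arg_le_pi _⟩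
    · rintro θ ⟨hθ, hθJ⟩
      have h := stationary_angular hs (hstat _ (hZsupp θ hθ))
      have hsum : ∑ j, ω j * max ⟪a j, circlePt θ⟫ 0 * ⟪a j, circlePt (θ + π / 2)⟫ =
          ∑ j ∈ J, ω j * ⟪a j, circlePt θ⟫ * ⟪a j, circlePt (θ + π / 2)⟫ := by
        rw [← Finset.sum_subset (Finset.subset_univ J)]
        · refine Finset.sum_congr rfl fun j hj => ?_
          rw [max_eq_left ((hθJ j).1 hj)]
        · intro j _ hj
          rw [hθJ j, not_le] at hj
          rw [max_eq_right hj.le, mul_zero, zero_mul]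
      rw [hsum] at h
      rw [(hP θ).deriv, ← mul_zero β, ← h, mul_add, Finset.mul_sum, Finset.mul_sum]
      congr 1
      refine Finset.sum_congr rfl fun j _ => ?_
      ring
  have hconst : ∀ θ, P θ = P 0 := fun θ =>
    is_const_of_deriv_eq_zero (fun θ => (hPan θ).differentiableAt) hP₀ θ 0
  have hW : ∀ θ, circlePotential β ν θ =
      (P 0 - β / 2 * ∑ j ∈ J, ω j * ((a j 0 ^ 2 + a j 1 ^ 2) / 2)) +
      (-(β / 2) * ∑ j ∈ J, ω j * ((a j 0 ^ 2 - a j 1 ^ 2) / 2)) * cos (2 * θ) +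
      (-(β / 2) * ∑ j ∈ J, ω j * (a j 0 * a j 1)) * sin (2 * θ) := by
    intro θ
    have hsq : ∑ j ∈ J, ω j * ⟪a j, circlePt θ⟫ ^ 2 =
        ∑ j ∈ J, ω j * ((a j 0 ^ 2 + a j 1 ^ 2) / 2) +
        (∑ j ∈ J, ω j * ((a j 0 ^ 2 - a j 1 ^ 2) / 2)) * cos (2 * θ) +
        (∑ j ∈ J, ω j * (a j 0 * a j 1)) * sin (2 * θ) := by
      rw [Finset.sum_mul, Finset.sum_mul, ← Finset.sum_add_distrib, ← Finset.sum_add_distrib]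
      refine Finset.sum_congr rfl fun j _ => ?_
      rw [inner_circlePt, cos_two_mul, sin_two_mul]
      linear_combination ω j * a j 1 ^ 2 * sin_sq_add_cos_sq θ
    have h : circlePotential β ν θ + β / 2 * ∑ j ∈ J, ω j * ⟪a j, circlePt θ⟫ ^ 2 = P 0 := hconst θ
    rw [hsq] at h
    linear_combination h
  intro U hU hθ₀ hμU
  refine measure_preimage_circlePt_ne_zero hβ ν hW hU hθ₀ ?_
  rw [hν, Measure.map_apply measurable_polarAngle (hU.preimage continuous_circlePt).measurableSet]
  refine measure_mono_null (fun x hx => ?_) (measure_union_null hμU hs)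
  by_cases hxs : x ∈ Metric.sphere (0 : EuclideanSpace ℝ (Fin 2)) 1
  · left
    rwa [Set.mem_preimage, Set.mem_preimage, circlePt_polarAngle hxs] at hx
  · exact Or.inr hxs

theorem analyticAt_of_measSupport_infinite {ι : Type*} [Fintype ι] {β : ℝ} (hβ : 0 < β)
    (ω : ι → ℝ) (a : ι → EuclideanSpace ℝ (Fin 2))
    (μ : Measure (EuclideanSpace ℝ (Fin 2))) [IsProbabilityMeasure μ]
    (hs : μ (Metric.sphere (0 : EuclideanSpace ℝ (Fin 2)) 1)ᶜ = 0)
    (hstat : ∀ x ∈ measSupport μ,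
      tangentProj x ((∫ y, Real.exp (β * ⟪x, y⟫) • y ∂μ)
        + ∑ j, (ω j * max ⟪a j, x⟫ 0) • a j) = 0)
    (hinf : (measSupport μ).Infinite) (θ₀ : ℝ) :
    AnalyticAt ℝ (fun θ : ℝ => ∑ j, ω j * max ⟪a j, circlePt θ⟫ 0 ^ 2) θ₀ := by
  set ν := μ.map polarAngle
  have : IsProbabilityMeasure ν :=
    Measure.isProbabilityMeasure_map measurable_polarAngle.aemeasurable
  let Q : ℝ → ℝ := fun θ =>
    circlePotential β ν θ + β / 2 * ∑ j, ω j * max ⟪a j, circlePt θ⟫ 0 ^ 2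
  have hQ : ∀ θ, HasDerivAt Q 0 θ := by
    intro θ
    have h := stationary_angular hs
      (hstat _ (circlePt_mem_measSupport_of_infinite hβ ω a μ hs hstat hinf θ))
    have hd : HasDerivAt Q (β * (∫ y, exp (β * cos (θ - y)) * sin (y - θ) ∂ν) +
        β / 2 * ∑ j, ω j * (2 * max ⟪a j, circlePt θ⟫ 0 * ⟪a j, circlePt (θ + π / 2)⟫)) θ := by
      refine (hasDerivAt_circlePotential β ν θ).add (HasDerivAt.const_mul _ ?_)
      refine HasDerivAt.fun_sum fun j _ => HasDerivAt.const_mul _ ?_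
      exact (hasDerivAt_max_zero_sq _).comp θ (hasDerivAt_inner_circlePt (a j) θ)
    convert hd using 1
    refine (mul_zero β).symm.trans ((congrArg _ h.symm).trans ?_)
    rw [mul_add, Finset.mul_sum, Finset.mul_sum]
    congr 1
    refine Finset.sum_congr rfl fun j _ => ?_
    ring
  have hconst : ∀ θ, Q θ = Q 0 := fun θ =>
    is_const_of_deriv_eq_zero (fun θ => (hQ θ).differentiableAt) (fun θ => (hQ θ).deriv) θ 0
  have hv : (fun θ : ℝ => ∑ j, ω j * max ⟪a j, circlePt θ⟫ 0 ^ 2) =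
      fun θ => 2 / β * (Q 0 - circlePotential β ν θ) := by
    ext θ
    rw [← hconst θ]
    simp only [Q]
    field_simp
    ring
  rw [hv]
  exact analyticAt_const.mul (analyticAt_const.sub (analyticAt_circlePotential β ν θ₀))

theorem measure_compl_measSupport {α : Type*} [TopologicalSpace α] [SecondCountableTopology α]
    [MeasurableSpace α] (μ : Measure α) : μ (measSupport μ)ᶜ = 0 := by
  refine measure_null_of_locally_null _ fun x hx => ?_
  simp only [measSupport, Set.mem_compl_iff, Set.mem_ofPred_eq, not_forall, not_not] at hx
  obtain ⟨U, hU, hxU, hμU⟩ := hx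
  exact ⟨U, mem_nhdsWithin_of_mem_nhds (hU.mem_nhds hxU), hμU⟩

theorem eq_sum_dirac_of_measSupport_finite {α : Type*} [TopologicalSpace α]
    [SecondCountableTopology α] [MeasurableSpace α] [MeasurableSingletonClass α] (μ : Measure α)
    (hfin : (measSupport μ).Finite) :
    μ = ∑ x ∈ hfin.toFinset, μ {x} • Measure.dirac x := by
  ext t ht
  rw [Measure.finsetSum_apply]
  simp only [Measure.smul_apply, Measure.dirac_apply' _ ht, smul_eq_mul]
  have h₁ : μ t = μ (t ∩ measSupport μ) :=
    (measure_inter_conull (measure_compl_measSupport μ)).symm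
  classical
  have h₂ : t ∩ measSupport μ = ↑(hfin.toFinset.filter (· ∈ t)) := by
    ext x
    simp [and_comm]
  rw [h₁, h₂, ← sum_measure_singleton, Finset.sum_filter]
  refine Finset.sum_congr rfl fun x _ => ?_
  by_cases hx : x ∈ t <;> simp [hx]

/-- **Atomicity of stationary measures on the circle for ReLU perceptrons** (Theorem
`circle`). Let `d = 2`, `β > 0`, and let the ReLU perceptron potential
`v(x) = Σ_j ω_j (max (⟨a_j, x⟩) 0)²` be such that `θ ↦ v(cos θ, sin θ)` is not real-analytic.
Then any Borel probability measure on `S¹` satisfying the stationarity condition is purely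
atomic with finite support. -/
theorem relu_stationary_on_circle_finite_support
    (β : ℝ) (hβ : 0 < β) (ω : Fin 2 → ℝ) (a : Fin 2 → EuclideanSpace ℝ (Fin 2))
    (hv : ¬ ∀ θ₀ : ℝ,
      AnalyticAt ℝ (fun θ : ℝ => ∑ j, ω j * max ⟪a j, circlePt θ⟫ 0 ^ 2) θ₀)
    (μ : Measure (EuclideanSpace ℝ (Fin 2))) [IsProbabilityMeasure μ]
    (hs : μ (Metric.sphere (0 : EuclideanSpace ℝ (Fin 2)) 1)ᶜ = 0)
    (hstat : ∀ x ∈ measSupport μ,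
      tangentProj x ((∫ y, Real.exp (β * ⟪x, y⟫) • y ∂μ)
        + ∑ j, (ω j * max ⟪a j, x⟫ 0) • a j) = 0) :
    ∃ (s : Finset (EuclideanSpace ℝ (Fin 2))) (c : EuclideanSpace ℝ (Fin 2) → ℝ≥0∞),
      μ = ∑ x ∈ s, c x • Measure.dirac x := by
  have hfin : (measSupport μ).Finite := by
    by_contra hinf
    exact hv (analyticAt_of_measSupport_infinite hβ ω a μ hs hstat hinf)
  exact ⟨hfin.toFinset, fun x => μ {x}, eq_sum_dirac_of_measSupport_finite μ hfin⟩
end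

section
/- Let d ≥ 2, β > 0, let σ : ℝ → ℝ be continuous, Φ a primitive of 2σ, and fix weights ω₁,…,ω_d ∈ ℝ, a₁,…,a_d ∈ ℝ^d. Define v(x) = Σ_{j=1}^{d} ω_j Φ(⟨a_j, x⟩) and the energy E[μ] = (1/(2β)) ∬ exp(β ⟨x,y⟩) dμ(x) dμ(y) + (1/2) ∫ v dμ over Borel probability measures μ on S^{d-1}. Then a measure μ is a global maximizer of E if and only if μ = δ_x for some x ∈ S^{d-1} with v(x) = max_{y ∈ S^{d-1}} v(y). -/
open MeasureTheory Real
open scoped RealInnerProductSpace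

/-- The perceptron potential `v(x) = Σ_j ω_j Φ(⟨a_j, x⟩)`, where `Φ` is a primitive
of `2σ`. -/
noncomputable def perceptronPotential {d : ℕ} (ω : Fin d → ℝ)
    (a : Fin d → EuclideanSpace ℝ (Fin d)) (Φ : ℝ → ℝ)
    (x : EuclideanSpace ℝ (Fin d)) : ℝ :=
  ∑ j, ω j * Φ ⟪a j, x⟫

/-- The attention–perceptron energy
`E[μ] = (1/(2β)) ∬ e^{β⟨x,y⟩} dμ dμ + (1/2) ∫ v dμ`. -/
noncomputable def attnEnergy {d : ℕ} (β : ℝ) (ω : Fin d → ℝ)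
    (a : Fin d → EuclideanSpace ℝ (Fin d)) (Φ : ℝ → ℝ)
    (μ : Measure (EuclideanSpace ℝ (Fin d))) : ℝ :=
  (1 / (2 * β)) * ∫ x, ∫ y, Real.exp (β * ⟪x, y⟫) ∂μ ∂μ
    + (1 / 2) * ∫ x, perceptronPotential ω a Φ x ∂μ

theorem eq_dirac_of_ae_eq {α : Type*} [MeasurableSpace α] {μ : Measure α}
    [IsProbabilityMeasure μ] {x : α} (h : ∀ᵐ y ∂μ, y = x) : μ = Measure.dirac x := by
  have h' : Measure.map id μ = Measure.map (fun _ => x) μ := Measure.map_congr h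
  simpa using h'

theorem integrable_of_continuous_of_compl_null {α : Type*} [TopologicalSpace α] [T2Space α]
    [MeasurableSpace α] [BorelSpace α] {μ : Measure α} [IsFiniteMeasure μ] {s : Set α}
    (hs : IsCompact s) (hμ : μ sᶜ = 0) {f : α → ℝ} (hf : Continuous f) : Integrable f μ := by
  have h : IntegrableOn f s μ := hf.continuousOn.integrableOn_compact' hs hs.measurableSet
  rwa [IntegrableOn, Measure.restrict_eq_self_of_ae_mem (mem_ae_iff.2 hμ)] at h

theorem ae_eq_const_of_le_integral {α : Type*} [MeasurableSpace α] {μ : Measure α}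
    [IsProbabilityMeasure μ] {f : α → ℝ} {c : ℝ} (hf : Integrable f μ) (hle : ∀ᵐ x ∂μ, f x ≤ c)
    (hc : c ≤ ∫ x, f x ∂μ) : ∀ᵐ x ∂μ, f x = c := by
  refine (integral_eq_iff_of_ae_le hf (integrable_const c) hle).1 (le_antisymm ?_ ?_)
  · exact integral_mono_ae hf (integrable_const c) hle
  · simpa using hc

theorem integral_le_const_of_ae_le {α : Type*} [MeasurableSpace α] {μ : Measure α}
    [IsProbabilityMeasure μ] {f : α → ℝ} {c : ℝ} (hf : Integrable f μ)
    (hle : ∀ᵐ x ∂μ, f x ≤ c) : ∫ x, f x ∂μ ≤ c := by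
  simpa using integral_mono_ae hf (integrable_const c) hle

section SphereKernel

variable {E : Type*} [NormedAddCommGroup E] [InnerProductSpace ℝ E]

theorem exp_mul_inner_le_of_mem_sphere {β : ℝ} (hβ : 0 < β) {x y : E}
    (hx : x ∈ Metric.sphere (0 : E) 1) (hy : y ∈ Metric.sphere (0 : E) 1) :
    Real.exp (β * ⟪x, y⟫) ≤ Real.exp β := by
  rw [mem_sphere_zero_iff_norm] at hx hy
  have h := real_inner_le_norm x y
  rw [hx, hy, one_mul] at h
  exact Real.exp_le_exp.2 (by nlinarith)

theorem exp_mul_inner_eq_iff_of_mem_sphere {β : ℝ} (hβ : 0 < β) {x y : E}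
    (hx : x ∈ Metric.sphere (0 : E) 1) (hy : y ∈ Metric.sphere (0 : E) 1) :
    Real.exp (β * ⟪x, y⟫) = Real.exp β ↔ x = y := by
  rw [mem_sphere_zero_iff_norm] at hx hy
  rw [Real.exp_eq_exp, mul_eq_left₀ hβ.ne', inner_eq_one_iff_of_norm_eq_one hx hy]

variable [MeasurableSpace E] [BorelSpace E] [FiniteDimensional ℝ E]

theorem continuous_integral_exp_mul_inner (β : ℝ) {μ : Measure E} [IsFiniteMeasure μ]
    (hs : μ (Metric.sphere (0 : E) 1)ᶜ = 0) :
    Continuous fun x : E => ∫ y, Real.exp (β * ⟪x, y⟫) ∂μ := by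
  have : ProperSpace E := FiniteDimensional.proper ℝ E
  have h := continuous_parametric_integral_of_continuous (μ := μ)
    (f := fun x y : E => Real.exp (β * ⟪x, y⟫))
    (by fun_prop) (isCompact_sphere (0 : E) 1)
  have hmem : ∀ᵐ x ∂μ, x ∈ Metric.sphere (0 : E) 1 := mem_ae_iff.2 hs
  rwa [Measure.restrict_eq_self_of_ae_mem hmem] at h

theorem integral_exp_mul_inner_le {β : ℝ} (hβ : 0 < β) {μ : Measure E} [IsProbabilityMeasure μ]
    (hs : μ (Metric.sphere (0 : E) 1)ᶜ = 0) {x : E} (hx : x ∈ Metric.sphere (0 : E) 1) :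
    ∫ y, Real.exp (β * ⟪x, y⟫) ∂μ ≤ Real.exp β := by
  have : ProperSpace E := FiniteDimensional.proper ℝ E
  refine integral_le_const_of_ae_le
    (integrable_of_continuous_of_compl_null (isCompact_sphere 0 1) hs (by fun_prop)) ?_
  filter_upwards [mem_ae_iff.2 hs] with y hy using exp_mul_inner_le_of_mem_sphere hβ hx hy

theorem integral_integral_exp_mul_inner_le {β : ℝ} (hβ : 0 < β) {μ : Measure E}
    [IsProbabilityMeasure μ] (hs : μ (Metric.sphere (0 : E) 1)ᶜ = 0) :
    ∫ x, ∫ y, Real.exp (β * ⟪x, y⟫) ∂μ ∂μ ≤ Real.exp β := by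
  have : ProperSpace E := FiniteDimensional.proper ℝ E
  refine integral_le_const_of_ae_le (integrable_of_continuous_of_compl_null
    (isCompact_sphere 0 1) hs (continuous_integral_exp_mul_inner β hs)) ?_
  filter_upwards [mem_ae_iff.2 hs] with x hx using integral_exp_mul_inner_le hβ hs hx

theorem exists_eq_dirac_of_le_integral_integral_exp_mul_inner {β : ℝ} (hβ : 0 < β)
    {μ : Measure E} [IsProbabilityMeasure μ] (hs : μ (Metric.sphere (0 : E) 1)ᶜ = 0)
    (h : Real.exp β ≤ ∫ x, ∫ y, Real.exp (β * ⟪x, y⟫) ∂μ ∂μ) :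
    ∃ x ∈ Metric.sphere (0 : E) 1, μ = Measure.dirac x := by
  have : ProperSpace E := FiniteDimensional.proper ℝ E
  have hmem : ∀ᵐ x ∂μ, x ∈ Metric.sphere (0 : E) 1 := mem_ae_iff.2 hs
  have hg : ∀ᵐ x ∂μ, ∫ y, Real.exp (β * ⟪x, y⟫) ∂μ = Real.exp β := by
    refine ae_eq_const_of_le_integral (integrable_of_continuous_of_compl_null
      (isCompact_sphere 0 1) hs (continuous_integral_exp_mul_inner β hs)) ?_ h
    filter_upwards [hmem] with x hx using integral_exp_mul_inner_le hβ hs hx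
  obtain ⟨x, hx, hgx⟩ := (hmem.and hg).exists
  refine ⟨x, hx, eq_dirac_of_ae_eq ?_⟩
  have hk : ∀ᵐ y ∂μ, Real.exp (β * ⟪x, y⟫) = Real.exp β := by
    refine ae_eq_const_of_le_integral (integrable_of_continuous_of_compl_null
      (isCompact_sphere 0 1) hs (by fun_prop)) ?_ hgx.ge
    filter_upwards [hmem] with y hy using exp_mul_inner_le_of_mem_sphere hβ hx hy
  filter_upwards [hmem, hk] with y hy hxy
    using ((exp_mul_inner_eq_iff_of_mem_sphere hβ hx hy).1 hxy).symm

end SphereKernel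

theorem continuous_perceptronPotential {d : ℕ} (ω : Fin d → ℝ)
    (a : Fin d → EuclideanSpace ℝ (Fin d)) {Φ : ℝ → ℝ} (hΦ : Continuous Φ) :
    Continuous (perceptronPotential ω a Φ) := by
  unfold perceptronPotential
  fun_prop

theorem integral_perceptronPotential_le {d : ℕ} (ω : Fin d → ℝ)
    (a : Fin d → EuclideanSpace ℝ (Fin d)) {Φ : ℝ → ℝ} (hΦ : Continuous Φ)
    {μ : Measure (EuclideanSpace ℝ (Fin d))} [IsProbabilityMeasure μ]
    (hs : μ (Metric.sphere (0 : EuclideanSpace ℝ (Fin d)) 1)ᶜ = 0) {c : ℝ}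
    (hc : ∀ y ∈ Metric.sphere (0 : EuclideanSpace ℝ (Fin d)) 1,
      perceptronPotential ω a Φ y ≤ c) :
    ∫ x, perceptronPotential ω a Φ x ∂μ ≤ c := by
  refine integral_le_const_of_ae_le (integrable_of_continuous_of_compl_null
    (isCompact_sphere 0 1) hs (continuous_perceptronPotential ω a hΦ)) ?_
  filter_upwards [mem_ae_iff.2 hs] with y hy using hc y hy

theorem attnEnergy_dirac {d : ℕ} (β : ℝ) (ω : Fin d → ℝ)
    (a : Fin d → EuclideanSpace ℝ (Fin d)) (Φ : ℝ → ℝ) {x : EuclideanSpace ℝ (Fin d)}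
    (hx : x ∈ Metric.sphere (0 : EuclideanSpace ℝ (Fin d)) 1) :
    attnEnergy β ω a Φ (Measure.dirac x)
      = (1 / (2 * β)) * Real.exp β + (1 / 2) * perceptronPotential ω a Φ x := by
  rw [mem_sphere_zero_iff_norm] at hx
  simp [attnEnergy, integral_dirac, hx]

/-- **Characterization of global maximizers** (Proposition `min.max` (i)). A probability
measure `μ` on `S^{d-1}` globally maximizes the attention–perceptron energy over probability
measures on the sphere if and only if `μ = δ_x` for some `x` maximizing the perceptron
potential `v` on the sphere. -/
theorem global_maximizers_are_diracs_at_potential_argmax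
    (d : ℕ) (hd : 2 ≤ d) (β : ℝ) (hβ : 0 < β)
    (σ : ℝ → ℝ) (hσ : Continuous σ) (Φ : ℝ → ℝ) (hΦ : ∀ s : ℝ, HasDerivAt Φ (2 * σ s) s)
    (ω : Fin d → ℝ) (a : Fin d → EuclideanSpace ℝ (Fin d))
    (μ : Measure (EuclideanSpace ℝ (Fin d))) [IsProbabilityMeasure μ]
    (hs : μ (Metric.sphere (0 : EuclideanSpace ℝ (Fin d)) 1)ᶜ = 0) :
    (∀ ν : Measure (EuclideanSpace ℝ (Fin d)), IsProbabilityMeasure ν →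
        ν (Metric.sphere (0 : EuclideanSpace ℝ (Fin d)) 1)ᶜ = 0 →
        attnEnergy β ω a Φ ν ≤ attnEnergy β ω a Φ μ)
      ↔ ∃ x ∈ Metric.sphere (0 : EuclideanSpace ℝ (Fin d)) 1,
          μ = Measure.dirac x ∧
          ∀ y ∈ Metric.sphere (0 : EuclideanSpace ℝ (Fin d)) 1,
            perceptronPotential ω a Φ y ≤ perceptronPotential ω a Φ x := by
  have hΦc : Continuous Φ := continuous_iff_continuousAt.2 fun s => (hΦ s).continuousAt
  have hpos : 0 < 1 / (2 * β) := by positivity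
  have hdirac : ∀ y ∈ Metric.sphere (0 : EuclideanSpace ℝ (Fin d)) 1,
      Measure.dirac y (Metric.sphere (0 : EuclideanSpace ℝ (Fin d)) 1)ᶜ = 0 := fun y hy =>
    mem_ae_iff.1 ((ae_dirac_iff Metric.isClosed_sphere.measurableSet).2 hy)
  constructor
  · intro hmax
    have hne : (Metric.sphere (0 : EuclideanSpace ℝ (Fin d)) 1).Nonempty :=
      Filter.Eventually.exists (f := ae μ) (mem_ae_iff.2 hs)
    obtain ⟨z, hz, hzmax⟩ := (isCompact_sphere (0 : EuclideanSpace ℝ (Fin d)) 1).exists_isMaxOn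
      hne (continuous_perceptronPotential ω a hΦc).continuousOn
    have hv := integral_perceptronPotential_le ω a hΦc hs (isMaxOn_iff.1 hzmax)
    have hE := hmax (Measure.dirac z) inferInstance (hdirac z hz)
    rw [attnEnergy_dirac β ω a Φ hz, attnEnergy] at hE
    obtain ⟨x, hx, rfl⟩ := exists_eq_dirac_of_le_integral_integral_exp_mul_inner hβ hs
      (le_of_mul_le_mul_left (by linarith) hpos)
    refine ⟨x, hx, rfl, fun y hy => ?_⟩
    have hyx := hmax (Measure.dirac y) inferInstance (hdirac y hy)
    rw [attnEnergy_dirac β ω a Φ hy, attnEnergy_dirac β ω a Φ hx] at hyx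
    linarith
  · rintro ⟨x, hx, rfl, hxmax⟩ ν _ hν
    rw [attnEnergy_dirac β ω a Φ hx, attnEnergy]
    have hv := integral_perceptronPotential_le ω a hΦc hν hxmax
    have hk := mul_le_mul_of_nonneg_left (integral_integral_exp_mul_inner_le hβ hν) hpos.le
    linarith
end
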